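/- arXiv:2401.15361 — 3 statements merged into one kernel-verified Lean document; each statement's English description precedes it below -/
import Mathlib

section
/- Let P be a d-polytope and 0 ≤ k ≤ d−1. Then f_k(P) ≥ ρ(d,k) · f_0(P). -/
noncomputable section

/-- Euclidean space `ℝ^n`. -/
abbrev Euc (n : ℕ) : Type := EuclideanSpace ℝ (Fin n)

/-- A polytope is the convex hull of finitely many points. -/
def IsPolytope {E : Type*} [NormedAddCommGroup E] [InnerProductSpace ℝ E] (P : Set E) : Prop :=
  ∃ V : Finset E, P = convexHull ℝ (V : Set E)

/-- `G` is a face of `P`: `P` itself, the empty set, or the intersection of `P` with a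
supporting hyperplane. -/
def IsFace {E : Type*} [NormedAddCommGroup E] [InnerProductSpace ℝ E] (P G : Set E) : Prop :=
  G = P ∨ G = ∅ ∨ ∃ f : E →L[ℝ] ℝ, f ≠ 0 ∧ ∃ c : ℝ,
    (∀ x ∈ P, f x ≤ c) ∧ G = {x ∈ P | f x = c}

/-- The (affine) dimension of a nonempty set. -/
noncomputable def dimSet {E : Type*} [NormedAddCommGroup E] [InnerProductSpace ℝ E]
    (s : Set E) : ℕ :=
  Module.finrank ℝ (affineSpan ℝ s).direction

/-- `G` is a `k`-dimensional face of `P`. -/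
def IsKFace {E : Type*} [NormedAddCommGroup E] [InnerProductSpace ℝ E]
    (P : Set E) (k : ℕ) (G : Set E) : Prop :=
  IsFace P G ∧ G.Nonempty ∧ dimSet G = k

/-- `fVec P k` is the number of `k`-dimensional faces of `P`. -/
noncomputable def fVec {E : Type*} [NormedAddCommGroup E] [InnerProductSpace ℝ E]
    (P : Set E) (k : ℕ) : ℕ :=
  {G | IsKFace P k G}.ncard

/-- `ρ(d,k) = (1/2)(binom(⌈d/2⌉,k) + binom(⌊d/2⌋,k))`. -/
def rho (d k : ℕ) : ℚ :=
  (((d + 1) / 2).choose k + (d / 2).choose k) / 2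

section ConeFaces

variable {W : Type*} [AddCommGroup W] [Module ℝ W]

/-- `T` is the face of the finite vector configuration `S` cut out by a linear functional that is
nonnegative on `S`. -/
def IsConeFace (S T : Finset W) : Prop :=
  ∃ x : Module.Dual ℝ W, (∀ w ∈ S, 0 ≤ x w) ∧ ∀ w, w ∈ T ↔ w ∈ S ∧ x w = 0

/-- The dimension of the linear span of a finite vector configuration. -/
def coneRank (S : Finset W) : ℕ := Module.finrank ℝ (Submodule.span ℝ (S : Set W))

theorem IsConeFace.subset {S T : Finset W} (h : IsConeFace S T) : T ⊆ S := by
  obtain ⟨x, -, hx⟩ := h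
  exact fun w hw => ((hx w).1 hw).1

theorem IsConeFace.refl (S : Finset W) : IsConeFace S S :=
  ⟨0, by simp, by simp⟩

theorem IsConeFace.of_subset {S F T : Finset W} (h : IsConeFace S T) (hTF : T ⊆ F) (hFS : F ⊆ S) :
    IsConeFace F T := by
  obtain ⟨x, h0, hx⟩ := h
  refine ⟨x, fun w hw => h0 w (hFS hw), fun w => ⟨fun hw => ⟨hTF hw, ((hx w).1 hw).2⟩, ?_⟩⟩
  rintro ⟨hw, hw0⟩
  exact (hx w).2 ⟨hFS hw, hw0⟩

theorem IsConeFace.trans {S F T : Finset W} (hF : IsConeFace S F) (hT : IsConeFace F T) :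
    IsConeFace S T := by
  have hFS := hF.subset
  have hTF := hT.subset
  obtain ⟨x, x0, hx⟩ := hF
  obtain ⟨y, y0, hy⟩ := hT
  obtain ⟨M, hM⟩ : ∃ M : ℝ, ∀ w ∈ S, 0 < x w → -y w < M * x w := by
    obtain ⟨M, hM⟩ := (S.image fun w => -y w / x w).bddAbove
    refine ⟨M + 1, fun w hw hpos => ?_⟩
    have h1 : -y w / x w ≤ M := hM (by simpa using ⟨w, hw, rfl⟩)
    rw [div_le_iff₀ hpos] at h1
    linarith
  have key : ∀ w ∈ S, 0 ≤ M * x w + y w ∧ (M * x w + y w = 0 ↔ w ∈ T) := by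
    intro w hw
    rcases (x0 w hw).eq_or_lt with h | h
    · have hwF : w ∈ F := (hx w).2 ⟨hw, h.symm⟩
      rw [← h, hy w]
      simp [hwF, y0 w hwF]
    · have := hM w hw h
      refine ⟨by linarith, fun h' => by linarith, fun h' => ?_⟩
      have := ((hx w).1 ((hy w).1 h').1).2
      linarith
  refine ⟨M • x + y, fun w hw => by simpa using (key w hw).1, fun w => ⟨fun hw => ?_, ?_⟩⟩
  · have hwS := hFS (hTF hw)
    exact ⟨hwS, by simpa using (key w hwS).2.2 hw⟩
  · rintro ⟨hw, h0⟩
    exact (key w hw).2.1 (by simpa using h0)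

/-- A polyhedron given by finitely many linear inequalities, restricted to a coset of the
annihilator of `U`, has a point where the tight constraints together with `U` span all constraints. -/
theorem exists_feasible_tight_span (S : Finset W) (c : W → ℝ) (U : Submodule ℝ W)
    (x₀ : Module.Dual ℝ W) (h₀ : ∀ w ∈ S, c w ≤ x₀ w) :
    ∃ x : Module.Dual ℝ W, (∀ w ∈ S, c w ≤ x w) ∧ (∀ w ∈ U, x w = x₀ w) ∧
      ∀ w ∈ S, w ∈ Submodule.span ℝ {v | v ∈ S ∧ x v = c v} ⊔ U := by
  classical
  let feas : Module.Dual ℝ W → Prop := fun x => (∀ w ∈ S, c w ≤ x w) ∧ ∀ w ∈ U, x w = x₀ w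
  obtain ⟨T, hT, hmax⟩ := Finset.exists_max_image
    (S.powerset.filter fun T => ∃ x, feas x ∧ T = S.filter fun v => x v = c v) Finset.card
    ⟨S.filter fun v => x₀ v = c v, by
      simp only [Finset.mem_filter, Finset.mem_powerset]
      exact ⟨Finset.filter_subset _ _, x₀, ⟨h₀, fun _ _ => rfl⟩, rfl⟩⟩
  obtain ⟨-, x, ⟨hx, hxU⟩, rfl⟩ := Finset.mem_filter.1 hT
  refine ⟨x, hx, hxU, ?_⟩
  by_contra! hcon
  obtain ⟨v, hv, hvs⟩ := hcon
  obtain ⟨f, hf, hle⟩ := Submodule.exists_le_ker_of_notMem hvs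
  have hker : ∀ w ∈ Submodule.span ℝ {v | v ∈ S ∧ x v = c v} ⊔ U, f w = 0 := fun w hw => hle hw
  obtain ⟨g, hgv, hg⟩ : ∃ g : Module.Dual ℝ W, g v < 0 ∧
      ∀ w ∈ Submodule.span ℝ {v | v ∈ S ∧ x v = c v} ⊔ U, g w = 0 := by
    rcases lt_or_gt_of_ne hf with h | h
    · exact ⟨f, h, hker⟩
    · exact ⟨-f, by simpa using h, fun w hw => by simp [hker w hw]⟩
  have hgT : ∀ w ∈ S, x w = c w → g w = 0 := fun w hw h =>
    hg w (Submodule.mem_sup_left (Submodule.subset_span ⟨hw, h⟩))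
  obtain ⟨i, hi, hmin⟩ := Finset.exists_min_image (S.filter fun w => g w < 0)
    (fun w => (x w - c w) / (-g w)) ⟨v, by simp [hv, hgv]⟩
  obtain ⟨hiS, hig⟩ := Finset.mem_filter.1 hi
  set t := (x i - c i) / (-g i) with ht
  have ht0 : 0 ≤ t := div_nonneg (by linarith [hx i hiS]) (by linarith)
  have hnew : feas (x + t • g) := by
    refine ⟨fun w hw => ?_, fun w hw => ?_⟩
    · simp only [LinearMap.add_apply, LinearMap.smul_apply, smul_eq_mul]
      rcases lt_or_ge (g w) 0 with h | h
      · have := hmin w (by simp [hw, h])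
        rw [le_div_iff₀ (by linarith)] at this
        linarith
      · nlinarith [hx w hw, mul_nonneg ht0 h]
    · simp [hxU w hw, hg w (Submodule.mem_sup_right hw)]
  have hti : x i + t * g i = c i := by
    have := div_mul_cancel₀ (x i - c i) (neg_ne_zero.2 hig.ne)
    rw [← ht] at this
    linarith
  have hlt := Finset.card_lt_card (s := S.filter fun v => x v = c v)
    (t := S.filter fun v => (x + t • g) v = c v) (by
      refine Finset.ssubset_iff_subset_ne.2 ⟨fun w hw => ?_, fun h => ?_⟩
      · obtain ⟨hwS, hw⟩ := Finset.mem_filter.1 hw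
        simp [hwS, hgT w hwS hw, hw]
      · have : i ∈ S.filter fun v => x v = c v := by
          rw [h]; simp [hiS, hti]
        exact hig.ne (hgT i hiS (Finset.mem_filter.1 this).2))
  refine absurd (hmax _ ?_) (not_le.2 hlt)
  exact Finset.mem_filter.2 ⟨Finset.mem_powerset.2 (Finset.filter_subset _ _), _, hnew, rfl⟩

theorem coneRank_mono {S T : Finset W} (h : T ⊆ S) : coneRank T ≤ coneRank S :=
  Submodule.finrank_mono (Submodule.span_mono (by exact_mod_cast h))

theorem dual_apply_eq_zero_of_mem_span {T : Finset W} {x : Module.Dual ℝ W}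
    (h : ∀ w ∈ T, x w = 0) {w : W} (hw : w ∈ Submodule.span ℝ (T : Set W)) : x w = 0 := by
  have : Submodule.span ℝ (T : Set W) ≤ LinearMap.ker x := Submodule.span_le.2 fun v hv => h v hv
  exact this hw

theorem IsConeFace.coneRank_lt {S T : Finset W} (h : IsConeFace S T) {r : W} (hr : r ∈ S)
    (hrT : r ∉ T) : coneRank T < coneRank S := by
  have hsub := h.subset
  obtain ⟨x, x0, hx⟩ := h
  refine Submodule.finrank_lt_finrank_of_lt (lt_of_le_of_ne
    (Submodule.span_mono (by exact_mod_cast hsub)) fun heq => hrT ?_)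
  refine (hx r).2 ⟨hr, dual_apply_eq_zero_of_mem_span (fun w hw => ((hx w).1 hw).2) ?_⟩
  rw [heq]
  exact Submodule.subset_span hr

/-- Every face is contained in a facet avoiding a prescribed vector outside the face. -/
theorem IsConeFace.exists_facet {S A : Finset W} (h : IsConeFace S A) {r : W} (hr : r ∈ S)
    (hrA : r ∉ A) : ∃ F, IsConeFace S F ∧ A ⊆ F ∧ r ∉ F ∧ coneRank F + 1 = coneRank S := by
  classical
  have hAS := h.subset
  obtain ⟨y, y0, hy⟩ := h
  have hyr : 0 < y r := lt_of_le_of_ne (y0 r hr) fun h => hrA ((hy r).2 ⟨hr, h.symm⟩)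
  obtain ⟨x, hx, hxU, hspan⟩ := exists_feasible_tight_span S (fun w => if w = r then 1 else 0)
    (Submodule.span ℝ (A : Set W)) ((y r)⁻¹ • y) (by
      intro w hw
      by_cases hwr : w = r
      · simp [hwr, hyr.ne']
      · simpa [hwr] using mul_nonneg (inv_nonneg.2 hyr.le) (y0 w hw))
  have hxr : 0 < x r := by
    have := hx r hr
    simp only [if_true] at this
    linarith
  have hF : IsConeFace S (S.filter fun w => x w = 0) := by
    refine ⟨x, fun w hw => ?_, fun w => Finset.mem_filter⟩
    have := hx w hw
    split_ifs at this <;> linarith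
  have hrF : r ∉ S.filter fun w => x w = 0 := by simp [hxr.ne']
  have hAF : A ⊆ S.filter fun w => x w = 0 := by
    intro w hw
    refine Finset.mem_filter.2 ⟨hAS hw, ?_⟩
    rw [hxU w (Submodule.subset_span hw)]
    simp [((hy w).1 hw).2]
  refine ⟨_, hF, hAF, hrF, le_antisymm (hF.coneRank_lt hr hrF) ?_⟩
  have hle : Submodule.span ℝ (S : Set W) ≤
      Submodule.span ℝ ((S.filter fun w => x w = 0 : Finset W) : Set W) ⊔ Submodule.span ℝ {r} := by
    refine Submodule.span_le.2 fun w hw => ?_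
    refine sup_le (α := Submodule ℝ W) ?_ ?_ (hspan w hw)
    · refine Submodule.span_le.2 ?_
      rintro v ⟨hvS, hv⟩
      by_cases hvr : v = r
      · exact Submodule.mem_sup_right (Submodule.subset_span hvr)
      · exact Submodule.mem_sup_left (Submodule.subset_span (by simpa [hvr, hvS] using hv))
    · exact (Submodule.span_mono (by exact_mod_cast hAF)).trans le_sup_left
  calc coneRank S ≤ _ := Submodule.finrank_mono hle
    _ ≤ _ := Submodule.finrank_add_le_finrank_add_finrank _ _
    _ ≤ _ := Nat.add_le_add_left (by simpa using finrank_span_le_card (R := ℝ) ({r} : Set W)) _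

/-- Every proper face is covered by a face of dimension one more. -/
theorem IsConeFace.exists_cover {S A : Finset W} (h : IsConeFace S A)
    (hlt : coneRank A < coneRank S) :
    ∃ B, IsConeFace S B ∧ A ⊆ B ∧ coneRank B = coneRank A + 1 := by
  induction hn : coneRank S generalizing S with
  | zero => omega
  | succ n ih =>
    by_cases hA : coneRank A = n
    · exact ⟨S, .refl S, h.subset, by omega⟩
    · obtain ⟨r, hr, hrA⟩ : ∃ r ∈ S, r ∉ A := by
        by_contra! hSA
        exact absurd (coneRank_mono hSA) (by omega)
      obtain ⟨F, hF, hAF, -, hFS⟩ := h.exists_facet hr hrA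
      obtain ⟨B, hB, hAB, hBr⟩ := ih (h.of_subset hAF hF.subset) (by omega) (by omega)
      exact ⟨B, hF.trans hB, hAB, hBr⟩

open Classical in
/-- The faces of `S` of a given rank. -/
def coneFaces (S : Finset W) (j : ℕ) : Finset (Finset W) :=
  S.powerset.filter fun T => IsConeFace S T ∧ coneRank T = j

theorem mem_coneFaces {S T : Finset W} {j : ℕ} :
    T ∈ coneFaces S j ↔ IsConeFace S T ∧ coneRank T = j := by
  classical
  simp only [coneFaces, Finset.mem_filter, Finset.mem_powerset, and_iff_right_iff_imp]
  exact fun h => h.1.subset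

open Classical in
/-- An interval of length `n` in the face lattice has at least `n.choose j` elements of
relative rank `j`. -/
theorem IsConeFace.choose_le_card {n : ℕ} {S A : Finset W} (h : IsConeFace S A)
    (hn : coneRank S = coneRank A + n) (j : ℕ) :
    n.choose j ≤ ((coneFaces S (coneRank A + j)).filter fun T => A ⊆ T).card := by
  induction n generalizing S A j with
  | zero =>
    cases j with
    | zero =>
      exact Finset.card_pos.2 ⟨A, by simp [mem_coneFaces, h]⟩
    | succ j => simp
  | succ n ih =>
    cases j with
    | zero =>
      rw [Nat.choose_zero_right]
      exact Finset.card_pos.2 ⟨A, by simp [mem_coneFaces, h]⟩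
    | succ j =>
      obtain ⟨B, hB, hAB, hBr⟩ := h.exists_cover (by omega)
      obtain ⟨r, hrB, hrA⟩ : ∃ r ∈ B, r ∉ A := by
        by_contra! hBA
        exact absurd (coneRank_mono hBA) (by omega)
      obtain ⟨F, hF, hAF, hrF, hFS⟩ := h.exists_facet (hB.subset hrB) hrA
      have h1 := ih (h.of_subset hAF hF.subset) (by omega) (j + 1)
      have h2 := ih hB (by omega) j
      rw [Nat.choose_succ_succ, add_comm]
      refine (Nat.add_le_add h1 h2).trans ?_
      rw [← Finset.card_union_of_disjoint]
      · refine Finset.card_le_card (Finset.union_subset ?_ ?_)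
        · intro T hT
          simp only [Finset.mem_filter, mem_coneFaces] at hT ⊢
          exact ⟨⟨hF.trans hT.1.1, hT.1.2⟩, hT.2⟩
        · intro T hT
          simp only [Finset.mem_filter, mem_coneFaces] at hT ⊢
          exact ⟨⟨hT.1.1, by omega⟩, hAB.trans hT.2⟩
      · refine Finset.disjoint_left.2 fun T hT hT' => ?_
        simp only [Finset.mem_filter, mem_coneFaces] at hT hT'
        exact hrF (hT.1.1.subset (hT'.2 hrB))

theorem coneRank_singleton {p : W} (hp : p ≠ 0) : coneRank {p} = 1 := by
  rw [coneRank, Finset.coe_singleton, finrank_span_singleton hp]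

/-- Two faces meet in a vertex `p`, lie on opposite sides of a hyperplane through `p`,
and have complementary dimensions. -/
theorem IsConeFace.exists_opposite_faces {S : Finset W} {p : W} (h : IsConeFace S {p}) (hp : p ≠ 0)
    (f : Module.Dual ℝ W) (hfp : f p = 0) (hf : ∀ w ∈ S, w ≠ p → f w ≠ 0) :
    ∃ F G, IsConeFace S F ∧ IsConeFace S G ∧ p ∈ F ∧ p ∈ G ∧ (∀ w ∈ F, w ≠ p → f w < 0) ∧
      (∀ w ∈ G, w ≠ p → 0 < f w) ∧ coneRank S + 1 ≤ coneRank F + coneRank G := by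
  classical
  have hpS : p ∈ S := h.subset (Finset.mem_singleton_self p)
  obtain ⟨y, y0, hy⟩ := h
  have hyp : y p = 0 := ((hy p).1 (Finset.mem_singleton_self p)).2
  obtain ⟨M, hM0, hM⟩ : ∃ M : ℝ, 0 ≤ M ∧ ∀ w ∈ S, w ≠ p → f w ≤ M * y w := by
    obtain ⟨M, hM⟩ := (S.image fun w => f w / y w).bddAbove
    refine ⟨max M 0, le_max_right _ _, fun w hw hwp => ?_⟩
    have hpos : 0 < y w := lt_of_le_of_ne (y0 w hw) fun h =>
      hwp (Finset.mem_singleton.1 ((hy w).2 ⟨hw, h.symm⟩))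
    rw [← div_le_iff₀ hpos]
    exact (hM (by simpa using ⟨w, hw, rfl⟩)).trans (le_max_left _ _)
  obtain ⟨x, hx, hxU, hspan⟩ := exists_feasible_tight_span S (fun w => max 0 (f w))
    (Submodule.span ℝ {p}) (M • y) (by
      intro w hw
      by_cases hwp : w = p
      · simp [hwp, hfp, hyp]
      · simpa using ⟨mul_nonneg hM0 (y0 w hw), hM w hw hwp⟩)
  have hxp : x p = 0 := by
    rw [hxU p (Submodule.mem_span_singleton_self p)]
    simp [hyp]
  have hx0 : ∀ w ∈ S, 0 ≤ x w := fun w hw => (le_max_left _ _).trans (hx w hw)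
  have hxf : ∀ w ∈ S, f w ≤ x w := fun w hw => (le_max_right _ _).trans (hx w hw)
  have hpF : p ∈ S.filter fun w => x w = 0 := by simp [hpS, hxp]
  have hpG : p ∈ S.filter fun w => x w = f w := by simp [hpS, hxp, hfp]
  refine ⟨S.filter fun w => x w = 0, S.filter fun w => x w = f w,
    ⟨x, hx0, fun w => Finset.mem_filter⟩,
    ⟨x - f, fun w hw => by simpa using hxf w hw, fun w => by simp [sub_eq_zero]⟩,
    hpF, hpG, ?_, ?_, ?_⟩
  · intro w hw hwp
    obtain ⟨hwS, hw⟩ := Finset.mem_filter.1 hw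
    exact lt_of_le_of_ne (hw ▸ hxf w hwS) (hf w hwS hwp)
  · intro w hw hwp
    obtain ⟨hwS, hw⟩ := Finset.mem_filter.1 hw
    exact lt_of_le_of_ne (hw ▸ hx0 w hwS) (hf w hwS hwp).symm
  · set F := S.filter fun w => x w = 0
    set G := S.filter fun w => x w = f w
    have hsup : Submodule.span ℝ (S : Set W) ≤
        Submodule.span ℝ (F : Set W) ⊔ Submodule.span ℝ (G : Set W) := by
      refine Submodule.span_le.2 fun w hw => ?_
      refine sup_le (α := Submodule ℝ W) ?_ ?_ (hspan w hw)
      · refine Submodule.span_le.2 ?_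
        rintro v ⟨hvS, hv⟩
        rcases max_choice 0 (f v) with h | h
        · exact Submodule.mem_sup_left (Submodule.subset_span (by simp [F, hvS, hv, h]))
        · exact Submodule.mem_sup_right (Submodule.subset_span (by simp [G, hvS, hv, h]))
      · exact Submodule.span_le.2 (Set.singleton_subset_iff.2
          (Submodule.mem_sup_left (Submodule.subset_span hpF)))
    have hinf : Submodule.span ℝ {p} ≤
        Submodule.span ℝ (F : Set W) ⊓ Submodule.span ℝ (G : Set W) :=
      Submodule.span_le.2 (Set.singleton_subset_iff.2
        ⟨Submodule.subset_span hpF, Submodule.subset_span hpG⟩)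
    have h1 := Submodule.finrank_mono hsup
    have h2 := Submodule.finrank_mono hinf
    rw [finrank_span_singleton hp] at h2
    have h3 := Submodule.finrank_sup_add_finrank_inf_eq
      (Submodule.span ℝ (F : Set W)) (Submodule.span ℝ (G : Set W))
    unfold coneRank
    omega

theorem eq_singleton_of_coneRank_eq_one {T : Finset W} (h : coneRank T = 1)
    (l : Module.Dual ℝ W) (hl : ∀ w ∈ T, l w = 1) : ∃ p, T = {p} := by
  obtain ⟨p, hp⟩ : T.Nonempty := by
    rw [Finset.nonempty_iff_ne_empty]
    rintro rfl
    rw [coneRank, Finset.coe_empty, Submodule.span_empty, finrank_bot] at h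
    omega
  refine ⟨p, Finset.eq_singleton_iff_unique_mem.2 ⟨hp, fun w hw => ?_⟩⟩
  have hp0 : p ≠ 0 := by
    rintro rfl
    simpa using hl 0 hp
  have heq : Submodule.span ℝ {p} = Submodule.span ℝ (T : Set W) :=
    Submodule.eq_of_le_of_finrank_eq (Submodule.span_mono (by simpa using hp))
      ((finrank_span_singleton hp0).trans h.symm)
  have hwp : w ∈ Submodule.span ℝ {p} := heq ▸ Submodule.subset_span hw
  obtain ⟨a, rfl⟩ := Submodule.mem_span_singleton.1 hwp
  have := hl _ hw
  rw [map_smul, hl p hp, smul_eq_mul, mul_one] at this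
  rw [this, one_smul]

open Classical in
/-- The faces of rank `j` on which `u` has `p` as its strict minimizer. -/
def facesWithMin (S : Finset W) (j : ℕ) (u : W → ℝ) (p : W) : Finset (Finset W) :=
  (coneFaces S j).filter fun Q => p ∈ Q ∧ ∀ w ∈ Q, w ≠ p → u p < u w

theorem sum_card_facesWithMin_le (S V : Finset W) (j : ℕ) (u : W → ℝ) :
    ∑ p ∈ V, (facesWithMin S j u p).card ≤ (coneFaces S j).card := by
  classical
  rw [← Finset.card_biUnion]
  · exact Finset.card_le_card (Finset.biUnion_subset.2 fun p _ => Finset.filter_subset _ _)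
  · intro p _ q _ hpq
    refine Finset.disjoint_left.2 fun Q hQ hQ' => ?_
    obtain ⟨-, hp, hpm⟩ := Finset.mem_filter.1 hQ
    obtain ⟨-, hq, hqm⟩ := Finset.mem_filter.1 hQ'
    exact lt_asymm (hpm q hq hpq.symm) (hqm p hp hpq)

theorem IsConeFace.choose_le_card_facesWithMin {S F : Finset W} {p : W} (hF : IsConeFace S F)
    (hp : IsConeFace S {p}) (hp0 : p ≠ 0) (hpF : p ∈ F) (u : W → ℝ)
    (hu : ∀ w ∈ F, w ≠ p → u p < u w) (k : ℕ) :
    (coneRank F - 1).choose k ≤ (facesWithMin S (k + 1) u p).card := by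
  classical
  have hsub : {p} ⊆ F := Finset.singleton_subset_iff.2 hpF
  have h1 := coneRank_singleton hp0
  have h2 := coneRank_mono hsub
  refine ((hp.of_subset hsub hF.subset).choose_le_card (n := coneRank F - 1) (by omega) k).trans
    (Finset.card_le_card fun T hT => ?_)
  simp only [Finset.mem_filter, mem_coneFaces, Finset.singleton_subset_iff, facesWithMin] at hT ⊢
  exact ⟨⟨hF.trans hT.1.1, by omega⟩, hT.2, fun w hw => hu w (hT.1.1.subset hw)⟩

theorem choose_add_choose_le {m n : ℕ} (h : m ≤ n) (i k : ℕ) :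
    (m + i).choose k + n.choose k ≤ m.choose k + (n + i).choose k := by
  induction i with
  | zero => simp
  | succ i ih =>
    cases k with
    | zero => simp
    | succ k =>
      rw [← add_assoc, ← add_assoc, Nat.choose_succ_succ', Nat.choose_succ_succ' (n + i)]
      have := Nat.choose_le_choose k (show m + i ≤ n + i by omega)
      omega

theorem choose_half_add_choose_half_le {a b d : ℕ} (h : d ≤ a + b) (k : ℕ) :
    ((d + 1) / 2).choose k + (d / 2).choose k ≤ a.choose k + b.choose k := by
  wlog hab : a ≤ b generalizing a b
  · rw [add_comm (a.choose k)]
    exact this (by omega) (by omega)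
  rcases le_total (d / 2) a with ha | ha
  · have h1 := Nat.choose_le_choose k ha
    have h2 := Nat.choose_le_choose k (show (d + 1) / 2 ≤ b by omega)
    omega
  · have h1 := choose_add_choose_le (show a ≤ (d + 1) / 2 by omega) (d / 2 - a) k
    have h2 := Nat.choose_le_choose k (show (d + 1) / 2 + (d / 2 - a) ≤ b by omega)
    rw [show a + (d / 2 - a) = d / 2 by omega] at h1
    omega

theorem exists_dual_injOn (S : Finset W) : ∃ u : Module.Dual ℝ W, Set.InjOn u S := by
  obtain ⟨u, hu⟩ := Module.exists_dual_forall_apply_ne_zero (K := ℝ)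
    (fun q : {q : S × S // q.1 ≠ q.2} => (q.1.1 : W) - q.1.2)
    fun q => sub_ne_zero.2 fun h => q.2 (Subtype.ext h)
  refine ⟨u, fun v hv w hw hvw => ?_⟩
  by_contra hne
  exact hu ⟨(⟨v, hv⟩, ⟨w, hw⟩), fun h => hne (congrArg Subtype.val h)⟩ (by simp [hvw])

theorem mul_card_coneFaces_one_le {S : Finset W} {d : ℕ} (hd : coneRank S = d + 1)
    (l : Module.Dual ℝ W) (hl : ∀ w ∈ S, l w = 1) (k : ℕ) :
    (((d + 1) / 2).choose k + (d / 2).choose k) * (coneFaces S 1).card ≤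
      2 * (coneFaces S (k + 1)).card := by
  classical
  obtain ⟨u, hu⟩ := exists_dual_injOn S
  set V := S.filter fun p => IsConeFace S {p} with hV
  have hcard : (coneFaces S 1).card ≤ V.card := by
    refine (Finset.card_le_card fun T hT => ?_).trans
      (Finset.card_image_le (s := V) (f := fun p => ({p} : Finset W)))
    obtain ⟨hT, hT1⟩ := mem_coneFaces.1 hT
    obtain ⟨p, rfl⟩ := eq_singleton_of_coneRank_eq_one hT1 l fun w hw => hl w (hT.subset hw)
    exact Finset.mem_image.2 ⟨p, by simpa [hV, hT] using hT.subset, rfl⟩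
  have hpt : ∀ p ∈ V, ((d + 1) / 2).choose k + (d / 2).choose k ≤
      (facesWithMin S (k + 1) (-u) p).card + (facesWithMin S (k + 1) u p).card := by
    intro p hp
    obtain ⟨hpS, hp⟩ := Finset.mem_filter.1 hp
    have hp0 : p ≠ 0 := by
      rintro rfl
      simpa using hl 0 hpS
    obtain ⟨F, G, hF, hG, hpF, hpG, hFu, hGu, hr⟩ := hp.exists_opposite_faces hp0 (u - u p • l)
      (by simp [hl p hpS]) fun w hw hwp => by
        simpa [hl w hw, sub_eq_zero] using fun h => hwp (hu hw hpS h)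
    refine (choose_half_add_choose_half_le (a := coneRank F - 1) (b := coneRank G - 1)
      (by omega) k).trans (Nat.add_le_add ?_ ?_)
    · refine hF.choose_le_card_facesWithMin hp hp0 hpF _ (fun w hw hwp => ?_) k
      simpa [hl w (hF.subset hw)] using hFu w hw hwp
    · refine hG.choose_le_card_facesWithMin hp hp0 hpG _ (fun w hw hwp => ?_) k
      simpa [hl w (hG.subset hw)] using hGu w hw hwp
  calc _ ≤ V.card • (((d + 1) / 2).choose k + (d / 2).choose k) := by
        rw [smul_eq_mul, mul_comm]
        exact Nat.mul_le_mul_right _ hcard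
    _ ≤ _ := Finset.card_nsmul_le_sum _ _ _ hpt
    _ ≤ _ := by
        rw [Finset.sum_add_distrib, two_mul]
        exact Nat.add_le_add (sum_card_facesWithMin_le S V _ _) (sum_card_facesWithMin_le S V _ _)

end ConeFaces

section Homogenization

variable {E : Type*}

/-- The embedding of a space as the affine hyperplane at height one. -/
def homogenize : E ↪ E × ℝ := ⟨fun v => (v, 1), fun _ _ h => congrArg Prod.fst h⟩

theorem homogenize_apply (v : E) : homogenize v = (v, 1) := rfl

theorem homogenize_preimage_map (V : Finset E) :
    homogenize ⁻¹' ((V.map homogenize : Finset (E × ℝ)) : Set (E × ℝ)) = V := by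
  rw [Finset.coe_map, Set.preimage_image_eq _ homogenize.injective]

variable [NormedAddCommGroup E] [InnerProductSpace ℝ E]

/-- The face of a convex hull in a supporting hyperplane is the convex hull of the generators in
that hyperplane. -/
theorem convexHull_inter_hyperplane (V : Finset E) (f : E →ₗ[ℝ] ℝ) (c : ℝ)
    (h : ∀ v ∈ V, f v ≤ c) :
    convexHull ℝ {v | v ∈ V ∧ f v = c} = {z ∈ convexHull ℝ (V : Set E) | f z = c} := by
  apply Set.Subset.antisymm
  · refine convexHull_min ?_ ((convex_convexHull ℝ _).inter
      (convex_hyperplane (f := f) f.isLinear c))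
    rintro v ⟨hv, hvc⟩
    exact ⟨subset_convexHull ℝ _ hv, hvc⟩
  · rintro z ⟨hz, hzc⟩
    obtain ⟨w, hw0, hw1, rfl⟩ := Finset.mem_convexHull'.1 hz
    have hsum : ∑ v ∈ V, w v * (c - f v) = 0 := by
      simp only [mul_sub, Finset.sum_sub_distrib, ← Finset.sum_mul, hw1, one_mul]
      rw [← hzc]
      simp
    have hzero := (Finset.sum_eq_zero_iff_of_nonneg fun v hv =>
      mul_nonneg (hw0 v hv) (sub_nonneg.2 (h v hv))).1 hsum
    classical
    have hcoe : {v | v ∈ V ∧ f v = c} = ((V.filter fun v => f v = c : Finset E) : Set E) := by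
      ext; simp
    have hoff : ∀ v ∈ V, v ∉ (V.filter fun v => f v = c) → w v = 0 := by
      intro v hv hvf
      refine (mul_eq_zero.1 (hzero v hv)).resolve_right fun h => hvf ?_
      exact Finset.mem_filter.2 ⟨hv, (sub_eq_zero.1 h).symm⟩
    rw [hcoe]
    refine Finset.mem_convexHull'.2 ⟨w, fun v hv => hw0 v (Finset.mem_filter.1 hv).1, ?_, ?_⟩
    · rw [← hw1]
      exact Finset.sum_subset (Finset.filter_subset _ _) hoff
    · exact Finset.sum_subset (Finset.filter_subset _ _) fun v hv hvf => by
        rw [hoff v hv hvf, zero_smul]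

/-- The convex hull of the points whose homogenizations lie in `Q`. -/
def dehomogenizedHull (Q : Finset (E × ℝ)) : Set E :=
  convexHull ℝ (homogenize ⁻¹' (Q : Set (E × ℝ)))

theorem apply_homogenize (x : Module.Dual ℝ (E × ℝ)) (v : E) :
    x (homogenize v) = x (0, 1) - (-(x ∘ₗ LinearMap.inl ℝ E ℝ)) v := by
  have : (homogenize v : E × ℝ) = (0, 1) + (v, 0) := by simp [homogenize_apply]
  rw [this, map_add]
  simp

theorem dehomogenizedHull_eq {V : Finset E} {Q : Finset (E × ℝ)} {x : Module.Dual ℝ (E × ℝ)}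
    (h0 : ∀ w ∈ V.map homogenize, 0 ≤ x w) (hx : ∀ w, w ∈ Q ↔ w ∈ V.map homogenize ∧ x w = 0) :
    dehomogenizedHull Q = {z ∈ convexHull ℝ (V : Set E) | x (homogenize z) = 0} := by
  have h : ∀ v ∈ V, (-(x ∘ₗ LinearMap.inl ℝ E ℝ)) v ≤ x (0, 1) := fun v hv => by
    have := h0 _ (Finset.mem_map_of_mem homogenize hv)
    rw [apply_homogenize] at this
    linarith
  have hiff : ∀ v, x (homogenize v) = 0 ↔ (-(x ∘ₗ LinearMap.inl ℝ E ℝ)) v = x (0, 1) := fun v => by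
    rw [apply_homogenize, sub_eq_zero, eq_comm]
  simp only [hiff]
  rw [← convexHull_inter_hyperplane V _ _ h, dehomogenizedHull]
  congr 1
  ext v
  rw [Set.mem_preimage, Finset.mem_coe, hx, Finset.mem_map', hiff]
  rfl

theorem homogenize_preimage_eq {V : Finset E} {Q : Finset (E × ℝ)}
    (h : IsConeFace (V.map homogenize) Q) :
    homogenize ⁻¹' (Q : Set (E × ℝ)) = (V : Set E) ∩ dehomogenizedHull Q := by
  have hsub := h.subset
  apply Set.Subset.antisymm
  · exact fun v hv => ⟨(Finset.mem_map' homogenize).1 (hsub hv), subset_convexHull ℝ _ hv⟩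
  · obtain ⟨x, h0, hx⟩ := h
    rintro v ⟨hv, hvQ⟩
    rw [dehomogenizedHull_eq h0 hx] at hvQ
    exact (hx _).2 ⟨Finset.mem_map_of_mem homogenize hv, hvQ.2⟩

theorem dehomogenizedHull_injOn (V : Finset E) :
    Set.InjOn dehomogenizedHull {Q | IsConeFace (V.map homogenize) Q} := by
  intro Q hQ R hR h
  have hpre : homogenize ⁻¹' (Q : Set (E × ℝ)) = homogenize ⁻¹' (R : Set (E × ℝ)) := by
    rw [homogenize_preimage_eq hQ, homogenize_preimage_eq hR, h]
  have himage : ∀ T : Finset (E × ℝ), IsConeFace (V.map homogenize) T →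
      homogenize '' (homogenize ⁻¹' (T : Set (E × ℝ))) = T := fun T hT =>
    Set.image_preimage_eq_of_subset fun w hw => by
      obtain ⟨v, -, hv⟩ := Finset.mem_map.1 (hT.subset hw)
      exact ⟨v, hv⟩
  rw [← Finset.coe_inj, ← himage Q hQ, ← himage R hR, hpre]

theorem coneRank_map_homogenize {T : Finset E} (hT : T.Nonempty) :
    coneRank (T.map homogenize) = dimSet (convexHull ℝ (T : Set E)) + 1 := by
  obtain ⟨p, hp⟩ := hT
  rw [dimSet, affineSpan_convexHull, direction_affineSpan, vectorSpan_eq_span_vsub_set_right ℝ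
    (Finset.mem_coe.2 hp)]
  set D := Submodule.span ℝ ((· -ᵥ p) '' (T : Set E)) with hD
  have hspan : Submodule.span ℝ ((T.map homogenize : Finset (E × ℝ)) : Set (E × ℝ)) =
      D.map (LinearMap.inl ℝ E ℝ) ⊔ Submodule.span ℝ {homogenize p} := by
    apply le_antisymm
    · refine Submodule.span_le.2 fun w hw => ?_
      obtain ⟨v, hv, rfl⟩ := Finset.mem_map.1 hw
      have : homogenize v = LinearMap.inl ℝ E ℝ (v - p) + homogenize p := by simp [homogenize_apply]
      rw [this]
      exact Submodule.add_mem_sup (Submodule.mem_map_of_mem (Submodule.subset_span ⟨v, hv, rfl⟩))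
        (Submodule.mem_span_singleton_self _)
    · have hmem : ∀ v ∈ T, homogenize v ∈
          Submodule.span ℝ ((T.map homogenize : Finset (E × ℝ)) : Set (E × ℝ)) := fun v hv =>
        Submodule.subset_span (Finset.mem_coe.2 (Finset.mem_map_of_mem homogenize hv))
      refine sup_le ?_ (Submodule.span_le.2 (Set.singleton_subset_iff.2 (hmem p hp)))
      rw [hD, Submodule.map_span_le]
      rintro _ ⟨v, hv, rfl⟩
      have : LinearMap.inl ℝ E ℝ (v -ᵥ p) = homogenize v - homogenize p := by simp [homogenize_apply]
      rw [this]
      exact Submodule.sub_mem _ (hmem v hv) (hmem p hp)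
  have hp0 : (homogenize p : E × ℝ) ≠ 0 := fun h => one_ne_zero (congrArg Prod.snd h)
  have hinf : D.map (LinearMap.inl ℝ E ℝ) ⊓ Submodule.span ℝ {homogenize p} = ⊥ := by
    rw [Submodule.eq_bot_iff]
    rintro w ⟨⟨v, -, rfl⟩, hw⟩
    obtain ⟨a, ha⟩ := Submodule.mem_span_singleton.1 hw
    have : a = 0 := by simpa [homogenize_apply] using congrArg Prod.snd ha
    rw [← ha, this, zero_smul]
  have : FiniteDimensional ℝ D := FiniteDimensional.span_of_finite ℝ (T.finite_toSet.image _)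
  have hrank := Submodule.finrank_sup_add_finrank_inf_eq
    (D.map (LinearMap.inl ℝ E ℝ)) (Submodule.span ℝ {homogenize p})
  rw [hinf, finrank_bot, finrank_span_singleton hp0, ← hspan,
    ← (Submodule.equivMapOfInjective _ LinearMap.inl_injective D).finrank_eq] at hrank
  exact hrank

theorem coneRank_eq_dimSet_add_one {V : Finset E} {Q : Finset (E × ℝ)}
    (h : Q ⊆ V.map homogenize) (hQ : Q.Nonempty) :
    coneRank Q = dimSet (dehomogenizedHull Q) + 1 := by
  obtain ⟨T, -, rfl⟩ := Finset.subset_map_iff.1 h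
  rw [dehomogenizedHull, homogenize_preimage_map]
  exact coneRank_map_homogenize (Finset.map_nonempty.1 hQ)

theorem exists_isConeFace_of_isFace {V : Finset E} {G : Set E}
    (h : IsFace (convexHull ℝ (V : Set E)) G) (hG : G.Nonempty) :
    ∃ Q, IsConeFace (V.map homogenize) Q ∧ dehomogenizedHull Q = G := by
  classical
  rcases h with rfl | rfl | ⟨f, -, c, hf, rfl⟩
  · exact ⟨_, .refl _, by rw [dehomogenizedHull, homogenize_preimage_map]⟩
  · exact absurd hG Set.not_nonempty_empty
  · let x : Module.Dual ℝ (E × ℝ) :=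
      c • LinearMap.snd ℝ E ℝ - f.toLinearMap ∘ₗ LinearMap.fst ℝ E ℝ
    have hxv : ∀ v, x (homogenize v) = c - f v := fun v => by simp [x, homogenize_apply]
    have h0 : ∀ w ∈ V.map homogenize, 0 ≤ x w := by
      intro w hw
      obtain ⟨v, hv, rfl⟩ := Finset.mem_map.1 hw
      rw [hxv]
      exact sub_nonneg.2 (hf v (subset_convexHull ℝ _ hv))
    have hx : ∀ w, w ∈ (V.map homogenize).filter (fun w => x w = 0) ↔
      w ∈ V.map homogenize ∧ x w = 0 := fun w => Finset.mem_filter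
    refine ⟨_, ⟨x, h0, hx⟩, ?_⟩
    rw [dehomogenizedHull_eq h0 hx]
    simp only [hxv, sub_eq_zero, eq_comm (a := c)]

theorem IsConeFace.isFace [FiniteDimensional ℝ E] {V : Finset E} {Q : Finset (E × ℝ)}
    (h : IsConeFace (V.map homogenize) Q) (hQ : Q.Nonempty) :
    IsFace (convexHull ℝ (V : Set E)) (dehomogenizedHull Q) := by
  have hsub := h.subset
  obtain ⟨x, h0, hx⟩ := h
  set f : E →ₗ[ℝ] ℝ := -(x ∘ₗ LinearMap.inl ℝ E ℝ) with hf
  have hxv : ∀ v, x (homogenize v) = x (0, 1) - f v := apply_homogenize x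
  rw [dehomogenizedHull_eq h0 hx]
  by_cases hf0 : f = 0
  · left
    obtain ⟨w, hw⟩ := hQ
    obtain ⟨v, hv, rfl⟩ := Finset.mem_map.1 (hsub hw)
    have hc := ((hx _).1 hw).2
    rw [hxv, hf0, LinearMap.zero_apply, sub_zero] at hc
    ext z
    simp [hxv, hf0, hc]
  · refine Or.inr (Or.inr ⟨f.toContinuousLinearMap, ?_, x (0, 1), ?_, ?_⟩)
    · exact fun h => hf0 (by simpa using h)
    · have hV : (V : Set E) ⊆ {z | f z ≤ x (0, 1)} := fun v hv => by
        have := h0 _ (Finset.mem_map_of_mem homogenize hv)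
        rw [hxv] at this
        exact sub_nonneg.1 this
      exact fun z hz => convexHull_min hV (convex_halfSpace_le f.isLinear _) hz
    · ext z
      simp only [Set.mem_ofPred_eq, hxv, sub_eq_zero, LinearMap.coe_toContinuousLinearMap']
      rw [eq_comm (a := f z)]

theorem fVec_convexHull [FiniteDimensional ℝ E] (V : Finset E) (j : ℕ) :
    fVec (convexHull ℝ (V : Set E)) j = (coneFaces (V.map homogenize) (j + 1)).card := by
  have hset : {G | IsKFace (convexHull ℝ (V : Set E)) j G} =
      dehomogenizedHull '' (coneFaces (V.map homogenize) (j + 1) : Set (Finset (E × ℝ))) := by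
    ext G
    simp only [Set.mem_ofPred_eq, Set.mem_image, Finset.mem_coe, mem_coneFaces]
    constructor
    · rintro ⟨hG, hne, hdim⟩
      obtain ⟨Q, hQ, rfl⟩ := exists_isConeFace_of_isFace hG hne
      obtain ⟨v, hv⟩ := convexHull_nonempty_iff.1 hne
      exact ⟨Q, ⟨hQ, by rw [coneRank_eq_dimSet_add_one hQ.subset ⟨_, hv⟩, hdim]⟩, rfl⟩
    · rintro ⟨Q, ⟨hQ, hrank⟩, rfl⟩
      have hne : Q.Nonempty := by
        rw [Finset.nonempty_iff_ne_empty]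
        rintro rfl
        rw [coneRank, Finset.coe_empty, Submodule.span_empty, finrank_bot] at hrank
        omega
      have hdim := coneRank_eq_dimSet_add_one hQ.subset hne
      obtain ⟨w, hw⟩ := hne
      obtain ⟨v, -, rfl⟩ := Finset.mem_map.1 (hQ.subset hw)
      exact ⟨hQ.isFace ⟨_, hw⟩, convexHull_nonempty_iff.2 ⟨v, hw⟩, by omega⟩
  rw [fVec, hset, Set.InjOn.ncard_image, Set.ncard_coe_finset]
  exact (dehomogenizedHull_injOn V).mono fun Q hQ => (mem_coneFaces.1 hQ).1

end Homogenization

/-- If `P` is a `d`-polytope and `0 ≤ k ≤ d-1`, then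
`f_k(P) ≥ ρ(d,k) ⬝ f_0(P)`. -/
theorem face_count_lower_bound_vertices {N : ℕ} (d k : ℕ) (P : Set (Euc N))
    (hP : IsPolytope P) (hd : dimSet P = d) (hk : k + 1 ≤ d) :
    rho d k * (fVec P 0 : ℚ) ≤ (fVec P k : ℚ) := by
  obtain ⟨V, rfl⟩ := hP
  have hV : V.Nonempty := by
    rw [Finset.nonempty_iff_ne_empty]
    rintro rfl
    rw [dimSet, affineSpan_convexHull, direction_affineSpan, Finset.coe_empty, vectorSpan_empty,
      finrank_bot] at hd
    omega
  have hrank := coneRank_map_homogenize hV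
  rw [hd] at hrank
  have key := mul_card_coneFaces_one_le hrank (LinearMap.snd ℝ (Euc N) ℝ) (fun w hw => by
    obtain ⟨v, -, rfl⟩ := Finset.mem_map.1 hw
    rfl) k
  rw [fVec_convexHull, fVec_convexHull, rho, zero_add]
  have key' : ((((d + 1) / 2).choose k : ℚ) + (d / 2).choose k) *
      (coneFaces (V.map homogenize) 1).card ≤ 2 * (coneFaces (V.map homogenize) (k + 1)).card := by
    exact_mod_cast key
  linarith
end
end

section
/- Let P be a d-polytope and 0 ≤ k ≤ d−1. Then f_k(P) ≥ ρ(d,d−k−1) · f_{d−1}(P). -/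
noncomputable section

open Module

namespace FiniteCone

section Algebraic

variable {W : Type*} [AddCommGroup W] [Module ℝ W]

/-- `X` is the zero set on `V` of a linear functional that is nonnegative on `V`. -/
def IsExposed (V X : Finset W) : Prop :=
  ∃ φ : Dual ℝ W, (∀ v ∈ V, 0 ≤ φ v) ∧ ∀ v, v ∈ X ↔ v ∈ V ∧ φ v = 0

theorem IsExposed.subset {V X : Finset W} (h : IsExposed V X) : X ⊆ V := by
  obtain ⟨φ, _, h⟩ := h
  exact fun v hv => ((h v).1 hv).1

theorem IsExposed.refl (V : Finset W) : IsExposed V V :=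
  ⟨0, by simp, by simp⟩

theorem IsExposed.restrict {V S X : Finset W} (h : IsExposed V X) (hX : X ⊆ S) (hS : S ⊆ V) :
    IsExposed S X := by
  obtain ⟨φ, h0, h⟩ := h
  exact ⟨φ, fun v hv => h0 v (hS hv),
    fun v => ⟨fun hv => ⟨hX hv, ((h v).1 hv).2⟩, fun hv => (h v).2 ⟨hS hv.1, hv.2⟩⟩⟩

/-- A large multiple of a positive functional dominates any functional on a finite set. -/
theorem exists_mul_add_pos (S : Finset W) (φ χ : Dual ℝ W) (h : ∀ v ∈ S, 0 < φ v) :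
    ∃ N : ℝ, ∀ v ∈ S, 0 < N * φ v + χ v := by
  have : ∀ᶠ N : ℝ in Filter.atTop, ∀ v ∈ S, 0 < N * φ v + χ v := by
    rw [Filter.eventually_all_finset]
    intro v hv
    filter_upwards [Filter.eventually_gt_atTop (-χ v / φ v)] with N hN
    rw [div_lt_iff₀ (h v hv)] at hN
    linarith
  exact this.exists

theorem IsExposed.trans {V S X : Finset W} (h : IsExposed V S) (h' : IsExposed S X) :
    IsExposed V X := by
  classical
  obtain ⟨φ, h0, h⟩ := h
  obtain ⟨χ, h0', h'⟩ := h'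
  obtain ⟨N, hN⟩ := exists_mul_add_pos (V.filter (fun v => v ∉ S)) φ χ (by
    intro v hv
    rw [Finset.mem_filter, h] at hv
    exact lt_of_le_of_ne (h0 v hv.1) (fun h => hv.2 ⟨hv.1, h.symm⟩))
  refine ⟨N • φ + χ, fun v hv => ?_, fun v => ?_⟩
  · by_cases hS : v ∈ S
    · simpa [((h v).1 hS).2] using h0' v hS
    · simpa using (hN v (by simp [hv, hS])).le
  · rw [h']
    refine ⟨fun hv => ⟨((h v).1 hv.1).1, by simp [((h v).1 hv.1).2, hv.2]⟩, fun hv => ?_⟩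
    by_cases hS : v ∈ S
    · exact ⟨hS, by simpa [((h v).1 hS).2] using hv.2⟩
    · have := hN v (by simp [hv.1, hS])
      have h2 := hv.2
      simp at h2
      linarith

theorem IsExposed.mem_of_mem_span {V X : Finset W} (h : IsExposed V X) {v : W} (hv : v ∈ V)
    (hs : v ∈ Submodule.span ℝ (X : Set W)) : v ∈ X := by
  obtain ⟨φ, h0, h⟩ := h
  refine (h v).2 ⟨hv, ?_⟩
  have : Submodule.span ℝ (X : Set W) ≤ LinearMap.ker φ := by
    rw [Submodule.span_le]
    exact fun x hx => ((h x).1 hx).2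
  exact this hs

theorem apply_eq_zero_of_mem_span {X : Finset W} {φ : Dual ℝ W} (h : ∀ v ∈ X, φ v = 0) {x : W}
    (hx : x ∈ Submodule.span ℝ (X : Set W)) : φ x = 0 := by
  have : Submodule.span ℝ (X : Set W) ≤ LinearMap.ker φ := by
    rw [Submodule.span_le]
    exact fun x hx => h x hx
  exact this hx

open Classical in
theorem isExposed_filter {V : Finset W} {φ : Dual ℝ W} (h : ∀ v ∈ V, 0 ≤ φ v) :
    IsExposed V (V.filter (fun v => φ v = 0)) :=
  ⟨φ, h, fun v => by simp⟩

theorem exists_isExposed_ratio (R : Finset W) (φ ψ : Dual ℝ W) (h0 : ∀ v ∈ R, 0 ≤ φ v)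
    (hz : ∀ v ∈ R, φ v = 0 → ψ v = 0) (hne : ¬ ∃ c : ℝ, ∀ v ∈ R, ψ v = c * φ v) :
    ∃ χ : Dual ℝ W, (∀ v ∈ R, 0 ≤ χ v) ∧ (∀ v ∈ R, φ v = 0 → χ v = 0) ∧
      (∃ v ∈ R, φ v ≠ 0 ∧ χ v = 0) ∧ ∃ v ∈ R, χ v ≠ 0 := by
  classical
  set S := R.filter (fun v => φ v ≠ 0) with hS
  have hSne : S.Nonempty := by
    by_contra hcon
    rw [Finset.not_nonempty_iff_eq_empty] at hcon
    refine hne ⟨0, fun v hv => ?_⟩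
    rw [zero_mul]
    refine hz v hv ?_
    by_contra h
    have : v ∈ S := by simp [hS, hv, h]
    simp [hcon] at this
  obtain ⟨u, hu, hmax⟩ := S.exists_max_image (fun v => ψ v / φ v) hSne
  have huR := (Finset.mem_filter.1 hu).1
  have huφ := (Finset.mem_filter.1 hu).2
  have hχz : ∀ v ∈ R, φ v = 0 → ((ψ u / φ u) • φ - ψ) v = 0 := by
    intro v hv hφ
    simp [hφ, hz v hv hφ]
  refine ⟨(ψ u / φ u) • φ - ψ, fun v hv => ?_, hχz, ⟨u, huR, huφ, ?_⟩, ?_⟩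
  · by_cases hφ : φ v = 0
    · exact (hχz v hv hφ).ge
    · have h1 := hmax v (by simp [hS, hv, hφ])
      have h2 : 0 < φ v := lt_of_le_of_ne (h0 v hv) (Ne.symm hφ)
      rw [div_le_iff₀ h2] at h1
      simpa using h1
  · simp [huφ]
  · by_contra! hcon
    refine hne ⟨ψ u / φ u, fun v hv => ?_⟩
    have := hcon v hv
    simp at this
    linarith

theorem IsExposed.eq_of_finrank_le {V X : Finset W} (h : IsExposed V X)
    (hr : (V : Set W).finrank ℝ ≤ (X : Set W).finrank ℝ) : X = V := by
  refine h.subset.antisymm fun v hv => h.mem_of_mem_span hv ?_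
  have hle : Submodule.span ℝ (X : Set W) ≤ Submodule.span ℝ (V : Set W) :=
    Submodule.span_mono (by exact_mod_cast h.subset)
  rw [Submodule.eq_of_le_of_finrank_le hle hr]
  exact Submodule.subset_span hv

theorem IsExposed.finrank_lt {V X : Finset W} (h : IsExposed V X) (hne : X ≠ V) :
    (X : Set W).finrank ℝ < (V : Set W).finrank ℝ :=
  lt_of_not_ge fun hr => hne (h.eq_of_finrank_le hr)

theorem exists_dual_not_proportional {Z R : Finset W}
    (hr : (Z : Set W).finrank ℝ + 2 ≤ (R : Set W).finrank ℝ) (φ : Dual ℝ W) :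
    ∃ ψ : Dual ℝ W, (∀ v ∈ Z, ψ v = 0) ∧ ¬ ∃ c : ℝ, ∀ v ∈ R, ψ v = c * φ v := by
  classical
  have key : ∀ r : W, ∃ ψ : Dual ℝ W, (∀ v ∈ Z, ψ v = 0) ∧ ψ r = 0 ∧ ∃ v ∈ R, ψ v ≠ 0 := by
    intro r
    have hlt : (insert r (Z : Set W)).finrank ℝ < (R : Set W).finrank ℝ := by
      have : (insert r (Z : Set W)).finrank ℝ ≤ (Z : Set W).finrank ℝ + 1 := by
        unfold Set.finrank
        rw [Set.insert_eq, Submodule.span_union]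
        have h1 := Submodule.finrank_add_le_finrank_add_finrank (Submodule.span ℝ {r})
          (Submodule.span ℝ (Z : Set W))
        have h2 := finrank_span_le_card (R := ℝ) ({r} : Set W)
        simp at h2
        omega
      omega
    have : ∃ v ∈ R, v ∉ Submodule.span ℝ (insert r (Z : Set W)) := by
      by_contra! hcon
      have : Submodule.span ℝ (R : Set W) ≤ Submodule.span ℝ (insert r (Z : Set W)) := by
        rw [Submodule.span_le]
        exact hcon
      have := FiniteDimensional.span_of_finite ℝ (Z.finite_toSet.insert r)
      exact absurd (Submodule.finrank_mono ‹_ ≤ Submodule.span ℝ _›) (not_le.2 hlt)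
    obtain ⟨v, hv, hvn⟩ := this
    obtain ⟨ψ, hψ, hle⟩ := Submodule.exists_le_ker_of_notMem hvn
    exact ⟨ψ, fun w hw => hle (Submodule.subset_span (Set.mem_insert_of_mem _ hw)),
      hle (Submodule.subset_span (Set.mem_insert _ _)), v, hv, hψ⟩
  by_cases hφ : ∃ r ∈ R, φ r ≠ 0
  · obtain ⟨r, hr, hφr⟩ := hφ
    obtain ⟨ψ, h1, h2, v, hv, h3⟩ := key r
    refine ⟨ψ, h1, fun ⟨c, hc⟩ => h3 ?_⟩
    have := hc r hr
    rw [h2, eq_comm, mul_eq_zero, or_iff_left hφr] at this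
    rw [hc v hv, this, zero_mul]
  · push Not at hφ
    obtain ⟨ψ, h1, h2, v, hv, h3⟩ := key 0
    exact ⟨ψ, h1, fun ⟨c, hc⟩ => h3 (by rw [hc v hv, hφ v hv, mul_zero])⟩

/-- Every proper face is contained in a facet. -/
theorem IsExposed.exists_facet {V T : Finset W} (hT : IsExposed V T) (hne : T ≠ V) :
    ∃ H, IsExposed V H ∧ T ⊆ H ∧ (H : Set W).finrank ℝ + 1 = (V : Set W).finrank ℝ := by
  classical
  obtain ⟨H, hH, hmax⟩ := (V.powerset.filter (fun H => IsExposed V H ∧ T ⊆ H ∧ H ≠ V)).exists_max_image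
    Finset.card ⟨T, by simp [hT.subset, hT, hne]⟩
  simp only [Finset.mem_filter, Finset.mem_powerset] at hH hmax
  obtain ⟨hHV, hHe, hTH, hHne⟩ := hH
  refine ⟨H, hHe, hTH, ?_⟩
  have hlt := hHe.finrank_lt hHne
  by_contra hcon
  obtain ⟨φ, h0, h⟩ := hHe
  obtain ⟨ψ, hψ, hprop⟩ := exists_dual_not_proportional (Z := H) (R := V) (by omega) φ
  obtain ⟨χ, hχ0, hχz, ⟨u, hu, huφ, huχ⟩, w, hw, hwχ⟩ := exists_isExposed_ratio V φ ψ h0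
    (fun v hv hφ => hψ v ((h v).2 ⟨hv, hφ⟩)) hprop
  have hsub : H ⊆ V.filter (fun v => χ v = 0) := fun v hv =>
    Finset.mem_filter.2 ⟨hHV hv, hχz v (hHV hv) ((h v).1 hv).2⟩
  have := hmax (V.filter (fun v => χ v = 0)) ⟨Finset.filter_subset _ _, isExposed_filter hχ0,
    hTH.trans hsub, fun heq => by
      rw [← heq] at hw
      exact hwχ (Finset.mem_filter.1 hw).2⟩
  have hss : H ⊂ V.filter (fun v => χ v = 0) :=
    (Finset.ssubset_iff_of_subset hsub).2 ⟨u, by simp [hu, huχ], fun hc => huφ ((h u).1 hc).2⟩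
  exact absurd (Finset.card_lt_card hss) (not_lt.2 this)

/-- Above every face there is a face of dimension one more that is not contained in a given
proper face. -/
theorem IsExposed.exists_atom {V T H : Finset W} (hT : IsExposed V T) (hH : IsExposed V H)
    (hTH : T ⊆ H) (hne : H ≠ V) :
    ∃ R, IsExposed V R ∧ T ⊆ R ∧ ¬ R ⊆ H ∧
      (R : Set W).finrank ℝ = (T : Set W).finrank ℝ + 1 := by
  classical
  obtain ⟨R, hR, hmin⟩ :=
    (V.powerset.filter (fun R => IsExposed V R ∧ T ⊆ R ∧ ¬ R ⊆ H)).exists_min_image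
    Finset.card ⟨V, by
      simp only [Finset.mem_filter, Finset.mem_powerset]
      exact ⟨subset_rfl, IsExposed.refl V, hT.subset, fun h => hne (hH.subset.antisymm h)⟩⟩
  simp only [Finset.mem_filter, Finset.mem_powerset] at hR hmin
  obtain ⟨hRV, hRe, hTR, hRH⟩ := hR
  refine ⟨R, hRe, hTR, hRH, ?_⟩
  have hTne : T ≠ R := fun h => hRH (h ▸ hTH)
  have hTe := hT.restrict hTR hRV
  have hlt := hTe.finrank_lt hTne
  by_contra hcon
  -- no proper face of `R` containing `T` leaves `H`
  have hmin' : ∀ χ : Dual ℝ W, (∀ v ∈ R, 0 ≤ χ v) → (∀ v ∈ T, χ v = 0) →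
      (∃ v ∈ R, v ∉ H ∧ χ v = 0) → ∀ v ∈ R, χ v = 0 := by
    intro χ h0 hz ⟨u, hu, huH, huχ⟩ v hv
    by_contra hvχ
    have := hmin (R.filter (fun v => χ v = 0)) ⟨(Finset.filter_subset _ _).trans hRV,
      hRe.trans (isExposed_filter h0), fun w hw => Finset.mem_filter.2 ⟨hTR hw, hz w hw⟩,
      fun hs => huH (hs (by simp [hu, huχ]))⟩
    have hss : R.filter (fun v => χ v = 0) ⊂ R :=
      (Finset.ssubset_iff_of_subset (Finset.filter_subset _ _)).2 ⟨v, hv, by simp [hvχ]⟩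
    exact absurd (Finset.card_lt_card hss) (not_lt.2 this)
  obtain ⟨η, hη0, hη⟩ := hH
  have hη0R : ∀ v ∈ R, 0 ≤ η v := fun v hv => hη0 v (hRV hv)
  have hηT : ∀ v ∈ T, η v = 0 := fun v hv => ((hη v).1 (hTH hv)).2
  have hηH : ∀ v ∈ R, v ∉ H → 0 < η v := fun v hv hvH =>
    lt_of_le_of_ne (hη0R v hv) fun h => hvH ((hη v).2 ⟨hRV hv, h.symm⟩)
  -- every functional nonnegative on `R` and zero on `T` is proportional to `η` on `R`
  have hprop : ∀ τ : Dual ℝ W, (∀ v ∈ R, 0 ≤ τ v) → (∀ v ∈ T, τ v = 0) →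
      ∃ c : ℝ, ∀ v ∈ R, τ v = c * η v := by
    intro τ h0 hz
    obtain ⟨u, hu, hum⟩ := (R.filter (fun v => v ∉ H)).exists_min_image (fun v => τ v / η v) (by
      obtain ⟨u, hu, huH⟩ := Finset.not_subset.1 hRH
      exact ⟨u, by simp [hu, huH]⟩)
    rw [Finset.mem_filter] at hu
    refine ⟨τ u / η u, fun v hv => ?_⟩
    have := hmin' (τ - (τ u / η u) • η) (fun w hw => ?_) (fun w hw => by simp [hz w hw, hηT w hw])
      ⟨u, hu.1, hu.2, by simp [(hηH u hu.1 hu.2).ne']⟩ v hv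
    · simp at this
      linarith
    · by_cases hwH : w ∈ H
      · simpa [((hη w).1 hwH).2] using h0 w hw
      · have := hum w (by simp [hw, hwH])
        rw [le_div_iff₀ (hηH w hw hwH)] at this
        simpa using this
  obtain ⟨τ, hτ0, hτ⟩ := hTe
  obtain ⟨c, hc⟩ := hprop τ hτ0 fun v hv => ((hτ v).1 hv).2
  obtain ⟨ψ, hψ, hψn⟩ := exists_dual_not_proportional (Z := T) (R := R) (by omega) η
  have hzT : ∀ v ∈ R, η v = 0 → v ∈ T := fun v hv h =>
    (hτ v).2 ⟨hv, by rw [hc v hv, h, mul_zero]⟩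
  obtain ⟨χ, hχ0, hχz, ⟨u, hu, huη, huχ⟩, w, hw, hwχ⟩ := exists_isExposed_ratio R η ψ hη0R
    (fun v hv h => hψ v (hzT v hv h)) hψn
  refine hwχ (hmin' χ hχ0 (fun v hv => hχz v (hTR hv) (hηT v hv)) ⟨u, hu, fun huH => ?_, huχ⟩ w hw)
  exact huη ((hη u).1 huH).2

open Classical in
/-- The faces of the cone generated by `V` of linear dimension `j`, as sets of generators. -/
def coneFaces (V : Finset W) (j : ℕ) : Finset (Finset W) :=
  V.powerset.filter (fun X => IsExposed V X ∧ (X : Set W).finrank ℝ = j)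

theorem mem_coneFaces {V X : Finset W} {j : ℕ} :
    X ∈ coneFaces V j ↔ IsExposed V X ∧ (X : Set W).finrank ℝ = j := by
  simp only [coneFaces, Finset.mem_filter, Finset.mem_powerset, and_iff_right_iff_imp]
  exact fun h => h.1.subset

open Classical in
theorem choose_le_card_coneFaces (n : ℕ) : ∀ {V T : Finset W} {j m : ℕ}, IsExposed V T →
    (V : Set W).finrank ℝ = (T : Set W).finrank ℝ + n → j + m = (V : Set W).finrank ℝ →
    n.choose m ≤ ((coneFaces V j).filter (fun X => T ⊆ X)).card := by
  induction n with
  | zero =>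
    intro V T j m hT hr hj
    rcases m with _ | m
    · rw [Nat.choose_zero_right, Nat.one_le_iff_ne_zero, ← Nat.pos_iff_ne_zero, Finset.card_pos]
      exact ⟨V, by simp [mem_coneFaces, IsExposed.refl, hT.subset, ← hj]⟩
    · simp
  | succ n ih =>
    intro V T j m hT hr hj
    rcases m with _ | m
    · rw [Nat.choose_zero_right, Nat.one_le_iff_ne_zero, ← Nat.pos_iff_ne_zero, Finset.card_pos]
      exact ⟨V, by simp [mem_coneFaces, IsExposed.refl, hT.subset, ← hj]⟩
    · have hne : T ≠ V := by
        rintro rfl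
        omega
      obtain ⟨H, hH, hTH, hHr⟩ := hT.exists_facet hne
      obtain ⟨R, hR, hTR, hRH, hRr⟩ := hT.exists_atom hH hTH (by rintro rfl; omega)
      have h1 := ih (j := j) (m := m) (hT.restrict hTH hH.subset) (by omega) (by omega)
      have h2 := ih (j := j) (m := m + 1) hR (by omega) hj
      rw [Nat.choose_succ_succ]
      refine (add_le_add h1 h2).trans ?_
      rw [← Finset.card_union_of_disjoint]
      · refine Finset.card_le_card (Finset.union_subset ?_ ?_)
        · intro X hX
          rw [Finset.mem_filter, mem_coneFaces] at hX ⊢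
          exact ⟨⟨hH.trans hX.1.1, hX.1.2⟩, hX.2⟩
        · intro X hX
          rw [Finset.mem_filter] at hX ⊢
          exact ⟨hX.1, hTR.trans hX.2⟩
      · rw [Finset.disjoint_left]
        intro X hX hX'
        rw [Finset.mem_filter, mem_coneFaces] at hX hX'
        exact hRH (hX'.2.trans hX.1.1.subset)

/-- Membership in the closed cone generated by `X`, expressed through the dual cone. -/
def InCone (X : Finset W) (x : W) : Prop :=
  ∀ φ : Dual ℝ W, (∀ v ∈ X, 0 ≤ φ v) → 0 ≤ φ x

theorem InCone.mem_span {X : Finset W} {x : W} (h : InCone X x) :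
    x ∈ Submodule.span ℝ (X : Set W) := by
  by_contra hx
  obtain ⟨φ, hφ, hle⟩ := Submodule.exists_le_ker_of_notMem hx
  have hz : ∀ v ∈ X, φ v = 0 := fun v hv => hle (Submodule.subset_span hv)
  have h1 := h φ fun v hv => (hz v hv).ge
  have h2 := h (-φ) fun v hv => by simp [hz v hv]
  simp at h2
  exact hφ (le_antisymm h2 h1)

theorem inCone_sum {X : Finset W} {a : W → ℝ} (ha : ∀ v ∈ X, 0 ≤ a v) :
    InCone X (∑ v ∈ X, a v • v) := by
  intro φ hφ
  simp only [map_sum, map_smul, smul_eq_mul]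
  exact Finset.sum_nonneg fun v hv => mul_nonneg (ha v hv) (hφ v hv)

open Classical in
theorem InCone.filter {X : Finset W} {x : W} (h : InCone X x) {φ : Dual ℝ W}
    (hφ : ∀ v ∈ X, 0 ≤ φ v) (hx : φ x = 0) : InCone (X.filter (fun v => φ v = 0)) x := by
  intro χ hχ
  obtain ⟨N, hN⟩ := exists_mul_add_pos (X.filter (fun v => φ v ≠ 0)) φ χ (by
    intro v hv
    rw [Finset.mem_filter] at hv
    exact lt_of_le_of_ne (hφ v hv.1) (Ne.symm hv.2))
  have := h (N • φ + χ) fun v hv => by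
    by_cases hv0 : φ v = 0
    · simpa [hv0] using hχ v (by simp [hv, hv0])
    · simpa using (hN v (by simp [hv, hv0])).le
  simpa [hx] using this

theorem eq_zero_of_inCone_line {X : Finset W} {x z : W} {h : Dual ℝ W} (hpos : ∀ v ∈ X, 0 < h v)
    (hz : ∀ t : ℝ, InCone X (x + t • z)) : z = 0 := by
  have key : ∀ φ : Dual ℝ W, (∀ v ∈ X, 0 ≤ φ v) → φ z = 0 := by
    intro φ hφ
    by_contra hne
    have := hz (-(φ x + 1) / φ z) φ hφ
    simp [div_mul_cancel₀ _ hne] at this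
    linarith
  rw [← Module.forall_dual_apply_eq_zero_iff ℝ]
  intro χ
  obtain ⟨N, hN⟩ := exists_mul_add_pos X h χ hpos
  have h1 := key h fun v hv => (hpos v hv).le
  have h2 := key (N • h + χ) fun v hv => by simpa using (hN v hv).le
  simpa [h1] using h2

end Algebraic

section Normed

variable {W : Type*} [NormedAddCommGroup W] [NormedSpace ℝ W]

/-- A point of the span either is a combination with positive coefficients or is separated from
all such combinations. -/
theorem exists_pos_combination_or_dual (X : Finset W) {x : W}
    (hx : x ∈ Submodule.span ℝ (X : Set W)) :
    (∃ a : W → ℝ, (∀ v ∈ X, 0 < a v) ∧ ∑ v ∈ X, a v • v = x) ∨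
      ∃ φ : Dual ℝ W, (∀ v ∈ X, 0 ≤ φ v) ∧ φ x ≤ 0 ∧ ∃ v ∈ X, φ v ≠ 0 := by
  classical
  let L : (X → ℝ) →ₗ[ℝ] Submodule.span ℝ (X : Set W) :=
    Fintype.linearCombination ℝ (fun v : X => ⟨v.1, Submodule.subset_span v.2⟩)
  have hL : ∀ a : X → ℝ, (L a : W) = ∑ v : X, a v • v.1 := by
    intro a
    simp [L, Fintype.linearCombination_apply]
  have hsurj : Function.Surjective L := by
    rintro ⟨y, hy⟩
    obtain ⟨f, hf⟩ := Submodule.mem_span_finset'.1 hy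
    exact ⟨f, Subtype.ext (by rw [hL]; exact hf)⟩
  set O : Set (X → ℝ) := {a | ∀ v, 0 < a v} with hO
  have hOo : IsOpen O := by
    have : O = ⋂ v, {a | 0 < a v} := by ext; simp [hO]
    rw [this]
    exact isOpen_iInter_of_finite fun v => isOpen_lt continuous_const (continuous_apply v)
  have hOc : Convex ℝ O := by
    intro a ha b hb s t hs ht hst v
    have := (convex_Ioi (0 : ℝ)) (ha v) (hb v) hs ht hst
    simpa using this
  by_cases hmem : (⟨x, hx⟩ : Submodule.span ℝ (X : Set W)) ∈ L '' O
  · left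
    obtain ⟨a, ha, hax⟩ := hmem
    refine ⟨fun v => if h : v ∈ X then a ⟨v, h⟩ else 0, fun v hv => by simpa [hv] using ha ⟨v, hv⟩, ?_⟩
    have := hL a
    rw [hax] at this
    rw [← Finset.sum_coe_sort]
    simpa using this.symm
  · right
    obtain ⟨f, hf⟩ := geometric_hahn_banach_open_point (hOc.linear_image L)
      (L.isOpenMap_of_finiteDimensional hsurj O hOo) hmem
    obtain ⟨φ, hφ⟩ := LinearMap.exists_extend (-(f : Submodule.span ℝ (X : Set W) →ₗ[ℝ] ℝ))
    have hφf : ∀ y : Submodule.span ℝ (X : Set W), φ y = - f y := fun y => by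
      simpa using LinearMap.congr_fun hφ y
    have key : ∀ a : W → ℝ, (∀ v ∈ X, 0 < a v) → φ x < ∑ v ∈ X, a v * φ v := by
      intro a ha
      have h1 := hf (L fun v => a v) ⟨_, fun v => ha v v.2, rfl⟩
      have h2 := hφf (L fun v => a v)
      have h3 := hφf ⟨x, hx⟩
      rw [hL, Finset.sum_coe_sort X (fun v => a v • v)] at h2
      simp only [map_sum, map_smul, smul_eq_mul] at h2 h3
      linarith
    refine ⟨φ, fun v hv => ?_, ?_, ?_⟩
    · by_contra! hneg
      have := key (fun w => 1 + if w = v then |φ x - ∑ v ∈ X, φ v| / (-φ v) else 0) (fun w _ => by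
        have : 0 ≤ |φ x - ∑ v ∈ X, φ v| / (-φ v) := div_nonneg (abs_nonneg _) (by linarith)
        split_ifs <;> linarith)
      simp only [add_mul, one_mul, ite_mul, zero_mul, Finset.sum_add_distrib,
        Finset.sum_ite_eq', hv, if_true] at this
      rw [div_neg, neg_mul, div_mul_cancel₀ _ hneg.ne] at this
      have := neg_abs_le (φ x - ∑ v ∈ X, φ v)
      linarith
    · by_contra! hcon
      set s := ∑ v ∈ X, φ v with hs
      have h1 := key (fun _ => φ x / (|s| + 1)) fun _ _ => by positivity
      rw [← Finset.mul_sum, ← hs, div_mul_eq_mul_div, lt_div_iff₀ (by positivity)] at h1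
      have h2 := le_abs_self s
      nlinarith
    · by_contra! hcon
      have h1 := key (fun _ => 1) fun _ _ => one_pos
      rw [apply_eq_zero_of_mem_span hcon hx, Finset.sum_congr rfl fun v hv => by
        rw [hcon v hv, mul_zero]] at h1
      simp at h1

/-- Every point in the span of a pointed cone is the difference of points on two faces whose
dimensions add up to at most the dimension of the cone. -/
theorem exists_isExposed_pair_sub {F : Finset W} {h : Dual ℝ W} (hpos : ∀ v ∈ F, 0 < h v) {p : W}
    (hp : p ∈ Submodule.span ℝ (F : Set W)) :
    ∃ X Y, IsExposed F X ∧ IsExposed F Y ∧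
      (X : Set W).finrank ℝ + (Y : Set W).finrank ℝ ≤ (F : Set W).finrank ℝ ∧
      ∃ x y, InCone X x ∧ InCone Y y ∧ p = x - y := by
  classical
  obtain ⟨⟨X, Y⟩, hXY, hmin⟩ := ((F.powerset ×ˢ F.powerset).filter (fun Z : Finset W × Finset W =>
    IsExposed F Z.1 ∧ IsExposed F Z.2 ∧ ∃ x y, InCone Z.1 x ∧ InCone Z.2 y ∧
      p = x - y)).exists_min_image (fun Z => Z.1.card + Z.2.card) (by
    obtain ⟨f, -, hf⟩ := Submodule.mem_span_finset.1 hp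
    refine ⟨(F, F), ?_⟩
    simp only [Finset.mem_filter, Finset.mem_product, Finset.mem_powerset_self, and_self, true_and]
    refine ⟨IsExposed.refl F, IsExposed.refl F, _, _, inCone_sum (a := fun v => max (f v) 0)
      fun v _ => le_max_right _ _, inCone_sum (a := fun v => max (-f v) 0)
      fun v _ => le_max_right _ _, ?_⟩
    rw [← Finset.sum_sub_distrib, ← hf]
    refine Finset.sum_congr rfl fun v _ => ?_
    rw [← sub_smul, max_zero_sub_max_neg_zero_eq_self])
  simp only [Finset.mem_filter, Finset.mem_product, Finset.mem_powerset] at hXY hmin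
  obtain ⟨⟨hXF, hYF⟩, hX, hY, x, y, hx, hy, hpxy⟩ := hXY
  refine ⟨X, Y, hX, hY, ?_, x, y, hx, hy, hpxy⟩
  have lt_of : ∀ {Z : Finset W} {φ : Dual ℝ W}, (∃ v ∈ Z, φ v ≠ 0) →
      (Z.filter (fun v => φ v = 0)).card < Z.card := fun ⟨v, hv, hne⟩ =>
    Finset.card_lt_card ((Finset.ssubset_iff_of_subset (Finset.filter_subset _ _)).2
      ⟨v, hv, by simp [hne]⟩)
  -- by minimality, every representation of `p` is in the relative interiors of both faces
  have hint : ∀ x y, InCone X x → InCone Y y → p = x - y →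
      (∃ a : W → ℝ, (∀ v ∈ X, 0 < a v) ∧ ∑ v ∈ X, a v • v = x) ∧
      ∃ a : W → ℝ, (∀ v ∈ Y, 0 < a v) ∧ ∑ v ∈ Y, a v • v = y := by
    intro x y hx hy hxy
    constructor
    · refine (exists_pos_combination_or_dual X hx.mem_span).resolve_right ?_
      rintro ⟨φ, h0, hle, hne⟩
      have := hmin (X.filter (fun v => φ v = 0), Y)
        ⟨⟨(Finset.filter_subset _ _).trans hXF, hYF⟩, hX.trans (isExposed_filter h0), hY, x, y,
          hx.filter h0 (le_antisymm hle (hx φ h0)), hy, hxy⟩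
      have := lt_of hne
      dsimp only at *
      omega
    · refine (exists_pos_combination_or_dual Y hy.mem_span).resolve_right ?_
      rintro ⟨φ, h0, hle, hne⟩
      have := hmin (X, Y.filter (fun v => φ v = 0))
        ⟨⟨hXF, (Finset.filter_subset _ _).trans hYF⟩, hX, hY.trans (isExposed_filter h0), x, y,
          hx, hy.filter h0 (le_antisymm hle (hy φ h0)), hxy⟩
      have := lt_of hne
      dsimp only at *
      omega
  have hdisj : Submodule.span ℝ (X : Set W) ⊓ Submodule.span ℝ (Y : Set W) = ⊥ := by
    rw [eq_bot_iff]
    rintro z ⟨hzX, hzY⟩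
    have near : ∀ {Z : Finset W} {w : W}, z ∈ Submodule.span ℝ (Z : Set W) →
        (∃ a : W → ℝ, (∀ v ∈ Z, 0 < a v) ∧ ∑ v ∈ Z, a v • v = w) →
        ∀ᶠ s : ℝ in nhds 0, InCone Z (w + s • z) := by
      rintro Z w hz ⟨a, ha, rfl⟩
      obtain ⟨α, -, rfl⟩ := Submodule.mem_span_finset.1 hz
      have : ∀ᶠ s : ℝ in nhds 0, ∀ v ∈ Z, 0 < a v + s * α v := by
        rw [Filter.eventually_all_finset]
        intro v hv
        have hc : Continuous fun s : ℝ => a v + s * α v := by fun_prop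
        exact hc.continuousAt.eventually (lt_mem_nhds (by simpa using ha v hv))
      filter_upwards [this] with s hs
      have := inCone_sum fun v hv => (hs v hv).le
      simpa only [Finset.smul_sum, ← Finset.sum_add_distrib, smul_smul, ← add_smul] using this
    have hclosed : ∀ (Z : Finset W) (w : W), IsClosed {t : ℝ | InCone Z (w + t • z)} := by
      intro Z w
      simp only [InCone, Set.ofPred_forall]
      refine isClosed_iInter fun φ => isClosed_iInter fun _ => isClosed_le continuous_const ?_
      simp only [map_add, map_smul, smul_eq_mul]
      fun_prop
    have hclopen : IsClopen {t : ℝ | InCone X (x + t • z) ∧ InCone Y (y + t • z)} := by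
      refine ⟨(hclosed X x).inter (hclosed Y y), isOpen_iff_mem_nhds.2 fun t ht => ?_⟩
      obtain ⟨hx', hy'⟩ := hint _ _ ht.1 ht.2 (by rw [hpxy]; abel)
      have := ((near hzX hx').and (near hzY hy'))
      have hsub : Filter.Tendsto (fun s : ℝ => s - t) (nhds t) (nhds 0) := by
        have : Continuous fun s : ℝ => s - t := by fun_prop
        simpa using this.tendsto t
      filter_upwards [hsub.eventually this] with s hs
      simpa only [add_assoc, ← add_smul, add_sub_cancel] using hs
    have huniv := hclopen.eq_univ ⟨0, by simpa using ⟨hx, hy⟩⟩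
    refine (Submodule.mem_bot ℝ).2 (eq_zero_of_inCone_line (X := X) (x := x) (h := h)
      (fun v hv => hpos v (hXF hv)) fun t => ?_)
    have : t ∈ {t : ℝ | InCone X (x + t • z) ∧ InCone Y (y + t • z)} := huniv ▸ Set.mem_univ t
    exact this.1
  have hsum := Submodule.finrank_sup_add_finrank_inf_eq (Submodule.span ℝ (X : Set W))
    (Submodule.span ℝ (Y : Set W))
  rw [hdisj, finrank_bot, add_zero] at hsum
  have hle : Submodule.span ℝ (X : Set W) ⊔ Submodule.span ℝ (Y : Set W) ≤
      Submodule.span ℝ (F : Set W) :=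
    sup_le (Submodule.span_mono (by exact_mod_cast hXF))
      (Submodule.span_mono (by exact_mod_cast hYF))
  exact hsum.symm.le.trans (Submodule.finrank_mono hle)

theorem choose_add_choose_le_of_le (m : ℕ) {a b : ℕ} (h : a ≤ b) :
    (a + 1).choose m + b.choose m ≤ a.choose m + (b + 1).choose m := by
  rcases m with _ | m
  · simp
  · have := Nat.choose_le_choose m h
    rw [Nat.choose_succ_succ a, Nat.choose_succ_succ b]
    simp only [Nat.succ_eq_add_one]
    omega

theorem choose_half_add_le_of_le (m : ℕ) : ∀ (n a b : ℕ), b - a ≤ n → a ≤ b →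
    ((a + b + 1) / 2).choose m + ((a + b) / 2).choose m ≤ a.choose m + b.choose m := by
  intro n
  induction n with
  | zero =>
    intro a b h1 h2
    obtain rfl : a = b := by omega
    rw [show (a + a + 1) / 2 = a by omega, show (a + a) / 2 = a by omega]
  | succ n ih =>
    intro a b h1 h2
    by_cases h : a + 2 ≤ b
    · obtain ⟨b, rfl⟩ : ∃ c, b = c + 1 := ⟨b - 1, by omega⟩
      have := ih (a + 1) b (by omega) (by omega)
      rw [show a + 1 + b = a + (b + 1) by omega] at this
      exact this.trans (choose_add_choose_le_of_le m (by omega))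
    · obtain rfl | rfl : b = a ∨ b = a + 1 := by omega
      · rw [show (b + b + 1) / 2 = b by omega, show (b + b) / 2 = b by omega]
      · rw [show (a + (a + 1) + 1) / 2 = a + 1 by omega, show (a + (a + 1)) / 2 = a by omega,
          add_comm]

theorem choose_half_add_le (m : ℕ) {d a b : ℕ} (h : d ≤ a + b) :
    ((d + 1) / 2).choose m + (d / 2).choose m ≤ a.choose m + b.choose m := by
  have h1 := Nat.choose_le_choose m (show (d + 1) / 2 ≤ (a + b + 1) / 2 by omega)
  have h2 := Nat.choose_le_choose m (show d / 2 ≤ (a + b) / 2 by omega)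
  refine (add_le_add h1 h2).trans ?_
  rcases le_total a b with hab | hab
  · exact choose_half_add_le_of_le m _ a b le_rfl hab
  · rw [add_comm a b, add_comm (a.choose m)]
    exact choose_half_add_le_of_le m _ b a le_rfl hab

/-- The facet normals, normalized at an interior point `e`, and a point `c` at which they take
pairwise distinct values. -/
theorem exists_generic_normals {V : Finset W} {d : ℕ}
    (hV : (V : Set W).finrank ℝ = d + 1) :
    ∃ (a : Finset W → Dual ℝ W) (e c : W), e ∈ Submodule.span ℝ (V : Set W) ∧
      c ∈ Submodule.span ℝ (V : Set W) ∧
      (∀ F ∈ coneFaces V d, (∀ v ∈ V, 0 ≤ a F v) ∧ (∀ v, v ∈ F ↔ v ∈ V ∧ a F v = 0) ∧ a F e = 1) ∧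
      ∀ F ∈ coneFaces V d, ∀ F' ∈ coneFaces V d, F' ≠ F → a F' c ≠ a F c := by
  classical
  set e := ∑ v ∈ V, v with he
  have : ∀ F ∈ coneFaces V d, ∃ a : Dual ℝ W,
      (∀ v ∈ V, 0 ≤ a v) ∧ (∀ v, v ∈ F ↔ v ∈ V ∧ a v = 0) ∧ a e = 1 := by
    intro F hF
    rw [mem_coneFaces] at hF
    obtain ⟨⟨φ, h0, hφ⟩, hr⟩ := hF
    have hpos : 0 < φ e := by
      rw [he, map_sum]
      refine Finset.sum_pos' h0 ?_
      by_contra! hcon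
      have : F = V := by
        ext v
        exact ⟨fun hv => ((hφ v).1 hv).1, fun hv => (hφ v).2 ⟨hv, le_antisymm (hcon v hv) (h0 v hv)⟩⟩
      rw [this] at hr
      omega
    refine ⟨(φ e)⁻¹ • φ, fun v hv => ?_, fun v => ?_, ?_⟩
    · simpa using mul_nonneg (inv_nonneg.2 hpos.le) (h0 v hv)
    · rw [hφ]
      simp [hpos.ne']
    · simp [hpos.ne']
  choose! a ha using this
  obtain ⟨c, hc, hne⟩ := Module.Dual.exists_forall_mem_ne_zero_of_forall_exists
    (Submodule.span ℝ (V : Set W))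
    (fun i : {q : coneFaces V d × coneFaces V d // q.2 ≠ q.1} =>
      a i.1.2.1 - a i.1.1.1) (by
    rintro ⟨⟨⟨F, hF⟩, ⟨F', hF'⟩⟩, hne⟩
    by_contra! hcon
    refine hne (Subtype.ext ?_)
    ext v
    rw [(ha F hF).2.1, (ha F' hF').2.1]
    refine and_congr_right fun hv => ?_
    have := hcon v (Submodule.subset_span hv)
    rw [LinearMap.sub_apply, sub_eq_zero] at this
    rw [this])
  refine ⟨a, e, c, Submodule.sum_mem _ fun v hv => Submodule.subset_span hv, hc, ha,
    fun F hF F' hF' hFF' => ?_⟩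
  exact sub_ne_zero.1 (hne ⟨(⟨F, hF⟩, ⟨F', hF'⟩), fun heq => hFF' (congrArg Subtype.val heq)⟩)

/-- The lower bound for the number of faces of a pointed polyhedral cone in terms of the number
of its facets. -/
theorem choose_mul_card_facets_le {V : Finset W} {h : Dual ℝ W} (hpos : ∀ v ∈ V, 0 < h v)
    {d j m : ℕ} (hV : (V : Set W).finrank ℝ = d + 1) (hj : j + m = d) :
    (((d + 1) / 2).choose m + (d / 2).choose m) * (coneFaces V d).card ≤
      2 * (coneFaces V j).card := by
  classical
  obtain ⟨a, e, c, he, hc, ha, hne⟩ := exists_generic_normals hV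
  let up (F : Finset W) := (coneFaces V j).filter
    (fun G => G ⊆ F ∧ ∀ F' ∈ coneFaces V d, F' ≠ F → G ⊆ F' → a F' c < a F c)
  let down (F : Finset W) := (coneFaces V j).filter
    (fun G => G ⊆ F ∧ ∀ F' ∈ coneFaces V d, F' ≠ F → G ⊆ F' → a F c < a F' c)
  have hlocal : ∀ F ∈ coneFaces V d,
      ((d + 1) / 2).choose m + (d / 2).choose m ≤ (up F).card + (down F).card := by
    intro F hF
    obtain ⟨h0, hz, hone⟩ := ha F hF
    have hFV : IsExposed V F := (mem_coneFaces.1 hF).1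
    have hFr : (F : Set W).finrank ℝ = d := (mem_coneFaces.1 hF).2
    set p := c - a F c • e with hp
    have hpF : p ∈ Submodule.span ℝ (F : Set W) := by
      set K := Submodule.span ℝ (V : Set W) ⊓ LinearMap.ker (a F) with hK
      have h1 : Submodule.span ℝ (F : Set W) ≤ K :=
        le_inf (Submodule.span_mono (by exact_mod_cast hFV.subset))
          (Submodule.span_le.2 fun v hv => ((hz v).1 hv).2)
      have h2 : K < Submodule.span ℝ (V : Set W) := by
        refine lt_of_le_of_ne inf_le_left fun heq => ?_
        have : e ∈ K := heq ▸ he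
        have : a F e = 0 := this.2
        rw [hone] at this
        exact one_ne_zero this
      have h3 := Submodule.finrank_lt_finrank_of_lt h2
      have h4 : finrank ℝ K ≤ finrank ℝ (Submodule.span ℝ (F : Set W)) := by
        unfold Set.finrank at hV hFr
        omega
      rw [Submodule.eq_of_le_of_finrank_le h1 h4]
      exact ⟨sub_mem hc (Submodule.smul_mem _ _ he), by simp [hp, hone]⟩
    obtain ⟨X, Y, hX, hY, hr, x, y, hx, hy, hxy⟩ :=
      exists_isExposed_pair_sub (fun v hv => hpos v (hFV.subset hv)) hpF
    have hval : ∀ F' ∈ coneFaces V d, a F' c - a F c = a F' x - a F' y := by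
      intro F' hF'
      rw [← map_sub, ← hxy, hp, map_sub, map_smul, (ha F' hF').2.2, smul_eq_mul, mul_one]
    have hnn : ∀ F' ∈ coneFaces V d, ∀ {Z : Finset W} {z : W}, Z ⊆ F → InCone Z z →
        0 ≤ a F' z := fun F' hF' Z z hZ hz =>
      hz _ fun v hv => (ha F' hF').1 v (hFV.subset (hZ hv))
    have hzero : ∀ F' ∈ coneFaces V d, ∀ {Z : Finset W} {z : W}, Z ⊆ F' → InCone Z z →
        a F' z = 0 := fun F' hF' Z z hZ hz =>
      apply_eq_zero_of_mem_span (fun v hv => (((ha F' hF').2.1 v).1 (hZ hv)).2) hz.mem_span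
    have hup : (d - (X : Set W).finrank ℝ).choose m ≤ (up F).card := by
      refine (choose_le_card_coneFaces _ (j := j) hX (by omega) (by omega)).trans
        (Finset.card_le_card fun G hG => ?_)
      rw [Finset.mem_filter, mem_coneFaces] at hG
      refine Finset.mem_filter.2 ⟨mem_coneFaces.2 ⟨hFV.trans hG.1.1, hG.1.2⟩, hG.1.1.subset,
        fun F' hF' hFF' hGF' => lt_of_le_of_ne ?_ (hne F hF F' hF' hFF')⟩
      have h1 := hval F' hF'
      rw [hzero F' hF' (hG.2.trans hGF') hx] at h1
      linarith [hnn F' hF' hY.subset hy]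
    have hdown : (d - (Y : Set W).finrank ℝ).choose m ≤ (down F).card := by
      refine (choose_le_card_coneFaces _ (j := j) hY (by omega) (by omega)).trans
        (Finset.card_le_card fun G hG => ?_)
      rw [Finset.mem_filter, mem_coneFaces] at hG
      refine Finset.mem_filter.2 ⟨mem_coneFaces.2 ⟨hFV.trans hG.1.1, hG.1.2⟩, hG.1.1.subset,
        fun F' hF' hFF' hGF' => lt_of_le_of_ne ?_ (hne F hF F' hF' hFF').symm⟩
      have h1 := hval F' hF'
      rw [hzero F' hF' (hG.2.trans hGF') hy] at h1
      linarith [hnn F' hF' hX.subset hx]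
    exact (choose_half_add_le m (by omega)).trans (add_le_add hup hdown)
  have hupsum : ∑ F ∈ coneFaces V d, (up F).card ≤ (coneFaces V j).card := by
    rw [← Finset.card_biUnion]
    · exact Finset.card_le_card (Finset.biUnion_subset.2 fun F _ => Finset.filter_subset _ _)
    · intro F hF F' hF' hFF'
      refine Finset.disjoint_left.2 fun G hG hG' => ?_
      rw [Finset.mem_filter] at hG hG'
      exact lt_asymm (hG.2.2 F' hF' hFF'.symm hG'.2.1) (hG'.2.2 F hF hFF' hG.2.1)
  have hdownsum : ∑ F ∈ coneFaces V d, (down F).card ≤ (coneFaces V j).card := by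
    rw [← Finset.card_biUnion]
    · exact Finset.card_le_card (Finset.biUnion_subset.2 fun F _ => Finset.filter_subset _ _)
    · intro F hF F' hF' hFF'
      refine Finset.disjoint_left.2 fun G hG hG' => ?_
      rw [Finset.mem_filter] at hG hG'
      exact lt_asymm (hG.2.2 F' hF' hFF'.symm hG'.2.1) (hG'.2.2 F hF hFF' hG.2.1)
  have := Finset.sum_le_sum hlocal
  rw [Finset.sum_const, smul_eq_mul, Finset.sum_add_distrib, mul_comm] at this
  omega

end Normed

end FiniteCone

namespace FiniteCone

open Classical in
/-- The generators of the cone over the polytope spanned by `V`. -/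
def homogenization {E : Type*} (V : Finset E) : Finset (E × ℝ) :=
  V.image fun x => (x, 1)

theorem mem_homogenization {E : Type*} {V : Finset E} {x : E} :
    (x, (1 : ℝ)) ∈ homogenization V ↔ x ∈ V := by
  simp [homogenization]

theorem forall_mem_homogenization {E : Type*} {V : Finset E} {p : E × ℝ → Prop} :
    (∀ v ∈ homogenization V, p v) ↔ ∀ v ∈ V, p (v, 1) := by
  simp [homogenization]

theorem exists_of_mem_homogenization {E : Type*} {V : Finset E} {z : E × ℝ}
    (hz : z ∈ homogenization V) : ∃ v ∈ V, (v, 1) = z := by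
  simpa [homogenization] using hz

section Polytope

variable {E : Type*} [NormedAddCommGroup E] [InnerProductSpace ℝ E]

theorem convexHull_inter_hyperplane (V : Finset E) (f : E →ₗ[ℝ] ℝ) (c : ℝ)
    (hf : ∀ v ∈ V, f v ≤ c) :
    {x ∈ convexHull ℝ (V : Set E) | f x = c} = convexHull ℝ {v | v ∈ V ∧ f v = c} := by
  classical
  ext x
  constructor
  · rintro ⟨hx, hxc⟩
    obtain ⟨w, hw0, hw1, rfl⟩ := Finset.mem_convexHull'.1 hx
    have hsum : ∑ v ∈ V, w v * (c - f v) = 0 := by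
      simp only [mul_sub, Finset.sum_sub_distrib, ← Finset.sum_mul, hw1, one_mul]
      rw [sub_eq_zero, ← hxc]
      simp
    have hz := (Finset.sum_eq_zero_iff_of_nonneg fun v hv =>
      mul_nonneg (hw0 v hv) (sub_nonneg.2 (hf v hv))).1 hsum
    have hne : ∀ v ∈ V, w v ≠ 0 → f v = c := fun v hv h =>
      (sub_eq_zero.1 ((mul_eq_zero.1 (hz v hv)).resolve_left h)).symm
    have hset : {v | v ∈ V ∧ f v = c} = (V.filter (fun v => f v = c) : Set E) := by
      ext
      simp
    rw [hset, Finset.mem_convexHull']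
    refine ⟨w, fun v hv => hw0 v (Finset.mem_filter.1 hv).1, ?_, ?_⟩
    · rw [Finset.sum_filter_of_ne hne, hw1]
    · exact Finset.sum_filter_of_ne fun v hv h => hne v hv fun h0 => h (by simp [h0])
  · intro hx
    refine ⟨convexHull_mono (fun v hv => hv.1) hx, ?_⟩
    exact convexHull_min (fun v hv => hv.2) (convex_hyperplane f.isLinear c) hx

theorem finrank_span_homogenization [FiniteDimensional ℝ E] {A : Set E} (hA : A.Nonempty) :
    ((fun x : E => (x, (1 : ℝ))) '' A).finrank ℝ = finrank ℝ (vectorSpan ℝ A) + 1 := by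
  obtain ⟨p, hp⟩ := hA
  have hspan : Submodule.span ℝ ((fun x : E => (x, (1 : ℝ))) '' A) =
      (vectorSpan ℝ A).map (LinearMap.inl ℝ E ℝ) ⊔ Submodule.span ℝ {(p, (1 : ℝ))} := by
    apply le_antisymm
    · rw [Submodule.span_le]
      rintro _ ⟨a, ha, rfl⟩
      refine Submodule.mem_sup.2 ⟨(a - p, 0), ⟨a - p, vsub_mem_vectorSpan ℝ ha hp, by simp⟩,
        (p, 1), Submodule.mem_span_singleton_self _, by simp⟩
    · refine sup_le ?_ ?_
      · rw [vectorSpan_def, Submodule.map_span, Submodule.span_le]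
        rintro _ ⟨_, ⟨a, ha, b, hb, rfl⟩, rfl⟩
        have := sub_mem (Submodule.subset_span (R := ℝ) (Set.mem_image_of_mem
          (fun x : E => (x, (1 : ℝ))) ha)) (Submodule.subset_span (Set.mem_image_of_mem
          (fun x : E => (x, (1 : ℝ))) hb))
        simpa using this
      · rw [Submodule.span_singleton_le_iff_mem]
        exact Submodule.subset_span ⟨p, hp, rfl⟩
  have hdisj : (vectorSpan ℝ A).map (LinearMap.inl ℝ E ℝ) ⊓
      Submodule.span ℝ {(p, (1 : ℝ))} = ⊥ := by
    rw [eq_bot_iff]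
    rintro z ⟨⟨y, -, rfl⟩, hz⟩
    obtain ⟨t, ht⟩ := Submodule.mem_span_singleton.1 hz
    have h2 : t = 0 := by simpa using congrArg Prod.snd ht
    rw [h2, zero_smul] at ht
    exact (Submodule.mem_bot ℝ).2 ht.symm
  have hsum := Submodule.finrank_sup_add_finrank_inf_eq
    ((vectorSpan ℝ A).map (LinearMap.inl ℝ E ℝ)) (Submodule.span ℝ {(p, (1 : ℝ))})
  rw [hdisj, finrank_bot, add_zero, ← hspan, finrank_span_singleton (by simp),
    ← (Submodule.equivMapOfInjective (LinearMap.inl ℝ E ℝ) LinearMap.inl_injective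
      (vectorSpan ℝ A)).finrank_eq] at hsum
  exact hsum

theorem dimSet_convexHull (A : Set E) : dimSet (convexHull ℝ A) = finrank ℝ (vectorSpan ℝ A) := by
  rw [dimSet, affineSpan_convexHull, direction_affineSpan]

/-- The set of points of the polytope lying over a face of its homogenization. -/
def slice (X : Finset (E × ℝ)) : Set E :=
  convexHull ℝ {x | (x, (1 : ℝ)) ∈ X}

theorem finrank_eq_dimSet_slice_add_one [FiniteDimensional ℝ E] {V : Finset E}
    {X : Finset (E × ℝ)} (hX : X ⊆ homogenization V) (hne : (slice X).Nonempty) :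
    (X : Set (E × ℝ)).finrank ℝ = dimSet (slice X) + 1 := by
  rw [slice, dimSet_convexHull, ← finrank_span_homogenization (convexHull_nonempty_iff.1 hne)]
  congr 1
  ext z
  constructor
  · intro hz
    obtain ⟨v, -, rfl⟩ := exists_of_mem_homogenization (hX hz)
    exact ⟨v, hz, rfl⟩
  · rintro ⟨v, hv, rfl⟩
    exact hv

theorem slice_nonempty {V : Finset E} {X : Finset (E × ℝ)} (hX : X ⊆ homogenization V)
    (hr : (X : Set (E × ℝ)).finrank ℝ ≠ 0) : (slice X).Nonempty := by
  rw [slice, convexHull_nonempty_iff]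
  obtain rfl | ⟨z, hz⟩ := X.eq_empty_or_nonempty
  · simp at hr
  · obtain ⟨v, -, rfl⟩ := exists_of_mem_homogenization (hX hz)
    exact ⟨v, hz⟩

theorem slice_eq_of_dual {V : Finset E} {X : Finset (E × ℝ)} {φ : Dual ℝ (E × ℝ)}
    (h0 : ∀ v ∈ homogenization V, 0 ≤ φ v)
    (hφ : ∀ v, v ∈ X ↔ v ∈ homogenization V ∧ φ v = 0) :
    slice X = {x ∈ convexHull ℝ (V : Set E) | φ (x, 1) = 0} := by
  have hdec : ∀ x, φ (x, 1) = φ (0, 1) - (-(φ ∘ₗ LinearMap.inl ℝ E ℝ)) x := by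
    intro x
    simp [← map_add]
  have hset : {x | (x, (1 : ℝ)) ∈ X} =
      {v | v ∈ V ∧ (-(φ ∘ₗ LinearMap.inl ℝ E ℝ)) v = φ (0, 1)} := by
    ext x
    rw [Set.mem_ofPred_eq, Set.mem_ofPred_eq, hφ, mem_homogenization, hdec x, sub_eq_zero,
      eq_comm (a := φ (0, 1))]
  rw [slice, hset, ← convexHull_inter_hyperplane]
  · ext x
    rw [Set.mem_ofPred_eq, Set.mem_ofPred_eq, hdec x, sub_eq_zero, eq_comm (a := φ (0, 1))]
  · intro v hv
    have := h0 _ (mem_homogenization.2 hv)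
    rw [hdec] at this
    linarith

theorem IsExposed.mem_iff_mem_slice {V : Finset E} {X : Finset (E × ℝ)}
    (hX : IsExposed (homogenization V) X) {v : E} (hv : v ∈ V) : (v, (1 : ℝ)) ∈ X ↔ v ∈ slice X := by
  refine ⟨fun h => subset_convexHull ℝ _ h, fun h => ?_⟩
  obtain ⟨φ, h0, hφ⟩ := hX
  rw [slice_eq_of_dual h0 hφ] at h
  exact (hφ _).2 ⟨mem_homogenization.2 hv, h.2⟩

theorem slice_injOn (V : Finset E) :
    Set.InjOn slice {X | IsExposed (homogenization V) X} := by
  have key : ∀ {X Y : Finset (E × ℝ)}, IsExposed (homogenization V) X →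
      IsExposed (homogenization V) Y → slice X = slice Y → X ⊆ Y := by
    intro X Y hX hY h z hz
    obtain ⟨v, hv, rfl⟩ := exists_of_mem_homogenization (hX.subset hz)
    rw [hY.mem_iff_mem_slice hv, ← h]
    exact (hX.mem_iff_mem_slice hv).1 hz
  exact fun X hX Y hY h => (key hX hY h).antisymm (key hY hX h.symm)

theorem isFace_slice [FiniteDimensional ℝ E] {V : Finset E} {X : Finset (E × ℝ)}
    (hX : IsExposed (homogenization V) X) : IsFace (convexHull ℝ (V : Set E)) (slice X) := by
  obtain ⟨φ, h0, hφ⟩ := hX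
  have hs := slice_eq_of_dual h0 hφ
  set f : E →L[ℝ] ℝ := LinearMap.toContinuousLinearMap (-(φ ∘ₗ LinearMap.inl ℝ E ℝ)) with hf
  have hdec : ∀ x, φ (x, 1) = φ (0, 1) - f x := by
    intro x
    simp [hf, ← map_add]
  by_cases hf0 : f = 0
  · have : ∀ x, φ (x, 1) = φ (0, 1) := fun x => by simp [hdec x, hf0]
    simp only [this] at hs
    by_cases hc : φ (0, 1) = 0
    · left
      simpa [hc] using hs
    · right; left
      simpa [hc] using hs
  · refine Or.inr (Or.inr ⟨f, hf0, φ (0, 1), ?_, ?_⟩)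
    · intro x hx
      refine convexHull_min (fun v hv => ?_) (convex_halfSpace_le f.toLinearMap.isLinear _) hx
      have := h0 _ (mem_homogenization.2 hv)
      rw [hdec] at this
      exact sub_nonneg.1 this
    · rw [hs]
      ext x
      rw [Set.mem_ofPred_eq, Set.mem_ofPred_eq, hdec, sub_eq_zero, eq_comm (a := φ (0, 1))]

theorem exists_slice_eq_of_isFace {V : Finset E} {G : Set E}
    (hG : IsFace (convexHull ℝ (V : Set E)) G) (hne : G.Nonempty) :
    ∃ X, IsExposed (homogenization V) X ∧ slice X = G := by
  obtain rfl | rfl | ⟨f, -, c, hle, rfl⟩ := hG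
  · refine ⟨homogenization V, IsExposed.refl _, ?_⟩
    simp only [slice, mem_homogenization]
    rfl
  · exact absurd hne Set.not_nonempty_empty
  · classical
    set φ : Dual ℝ (E × ℝ) := c • LinearMap.snd ℝ E ℝ - f.toLinearMap ∘ₗ LinearMap.fst ℝ E ℝ with hφ
    have hval : ∀ x, φ (x, 1) = c - f x := by
      intro x
      simp [hφ]
    have h0 : ∀ v ∈ homogenization V, 0 ≤ φ v := by
      rw [forall_mem_homogenization]
      intro v hv
      rw [hval]
      exact sub_nonneg.2 (hle v (subset_convexHull ℝ _ hv))
    refine ⟨_, isExposed_filter h0, ?_⟩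
    rw [slice_eq_of_dual h0 fun v => Finset.mem_filter]
    ext x
    rw [Set.mem_ofPred_eq, Set.mem_ofPred_eq, hval, sub_eq_zero, eq_comm (a := c)]

/-- The `k`-faces of a polytope correspond to the `(k+1)`-dimensional faces of the cone over it. -/
theorem fVec_convexHull [FiniteDimensional ℝ E] (V : Finset E) (k : ℕ) :
    fVec (convexHull ℝ (V : Set E)) k = (coneFaces (homogenization V) (k + 1)).card := by
  have himage : {G | IsKFace (convexHull ℝ (V : Set E)) k G} =
      slice '' (coneFaces (homogenization V) (k + 1) : Set (Finset (E × ℝ))) := by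
    ext G
    constructor
    · rintro ⟨hG, hne, hdim⟩
      obtain ⟨X, hX, rfl⟩ := exists_slice_eq_of_isFace hG hne
      refine ⟨X, mem_coneFaces.2 ⟨hX, ?_⟩, rfl⟩
      rw [finrank_eq_dimSet_slice_add_one hX.subset hne, hdim]
    · rintro ⟨X, hX, rfl⟩
      obtain ⟨hX, hr⟩ := mem_coneFaces.1 hX
      have hne := slice_nonempty hX.subset (by omega)
      refine ⟨isFace_slice hX, hne, ?_⟩
      have := finrank_eq_dimSet_slice_add_one hX.subset hne
      omega
  rw [fVec, himage, Set.InjOn.ncard_image, Set.ncard_coe_finset]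
  exact (slice_injOn V).mono fun X hX => (mem_coneFaces.1 hX).1

end Polytope

end FiniteCone

/-- If `P` is a `d`-polytope and `0 ≤ k ≤ d-1`, then
`f_k(P) ≥ ρ(d,d-k-1) ⬝ f_{d-1}(P)`. -/
theorem face_count_lower_bound_facets {N : ℕ} (d k : ℕ) (P : Set (Euc N))
    (hP : IsPolytope P) (hd : dimSet P = d) (hk : k + 1 ≤ d) :
    rho d (d - k - 1) * (fVec P (d - 1) : ℚ) ≤ (fVec P k : ℚ) := by
  obtain ⟨V, rfl⟩ := hP
  have hslice : FiniteCone.slice (FiniteCone.homogenization V) = convexHull ℝ (V : Set (Euc N)) := by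
    simp only [FiniteCone.slice, FiniteCone.mem_homogenization]
    rfl
  have hne : (convexHull ℝ (V : Set (Euc N))).Nonempty := by
    by_contra hcon
    rw [Set.not_nonempty_iff_eq_empty] at hcon
    have : dimSet (∅ : Set (Euc N)) = 0 := by simp [dimSet]
    rw [hcon, this] at hd
    omega
  have hV : (FiniteCone.homogenization V : Set (Euc N × ℝ)).finrank ℝ = d + 1 := by
    rw [FiniteCone.finrank_eq_dimSet_slice_add_one subset_rfl (by rwa [hslice]), hslice, hd]
  have hmain := FiniteCone.choose_mul_card_facets_le (h := LinearMap.snd ℝ (Euc N) ℝ)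
    (FiniteCone.forall_mem_homogenization.2 fun v _ => by simp) hV
    (show k + 1 + (d - k - 1) = d by omega)
  rw [FiniteCone.fVec_convexHull, FiniteCone.fVec_convexHull, show d - 1 + 1 = d by omega, rho]
  have hcast := (Nat.cast_le (α := ℚ)).2 hmain
  push_cast at hcast
  linarith
end
end

section
/- Let P be a d-polytope and 0 ≤ k ≤ d−1. Then f_k(P) = ρ(d,k) · f_0(P) holds if and only if k = 0, or k = 1 and P is simple. -/
noncomputable section

/-- A `d`-polytope is simple if each of its vertices is contained in exactly `d` facets. -/
def IsSimplePolytope {E : Type*} [NormedAddCommGroup E] [InnerProductSpace ℝ E]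
    (P : Set E) (d : ℕ) : Prop :=
  ∀ v : Set E, IsKFace P 0 v → {F : Set E | IsKFace P (d - 1) F ∧ v ⊆ F}.ncard = d

namespace VectorConfig

open Module Finset Submodule
open scoped Classical

variable {M : Type*} [AddCommGroup M] [Module ℝ M]

/-- `A` is a face of the finite vector configuration `V`: the set of vectors of `V` on which some
linear functional that is nonnegative on `V` vanishes. -/
def IsFaceOf (A V : Finset M) : Prop :=
  ∃ φ : Dual ℝ M, (∀ x ∈ V, 0 ≤ φ x) ∧ ∀ x, x ∈ A ↔ x ∈ V ∧ φ x = 0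

/-- The rank of a finite vector configuration. -/
def rk (A : Finset M) : ℕ := finrank ℝ (span ℝ (A : Set M))

/-- The faces of `V` of rank `j` that contain `E`. -/
def facesAbove (V E : Finset M) (j : ℕ) : Finset (Finset M) :=
  V.powerset.filter fun K => IsFaceOf K V ∧ E ⊆ K ∧ rk K = j

/-- The faces of `V` of rank `j` on which `ψ` is maximal at the element `v`. -/
def topFaces (V : Finset M) (ψ : Dual ℝ M) (v : M) (j : ℕ) : Finset (Finset M) :=
  (facesAbove V {v} j).filter fun K => ∀ x ∈ K, ψ x ≤ ψ v

/-- The elements of `V` that form a face on their own. -/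
def vertices (V : Finset M) : Finset M := V.filter fun v => IsFaceOf {v} V

theorem IsFaceOf.subset {A V : Finset M} (h : IsFaceOf A V) : A ⊆ V := by
  obtain ⟨φ, -, h⟩ := h
  exact fun x hx => ((h x).1 hx).1

theorem IsFaceOf.refl (V : Finset M) : IsFaceOf V V := ⟨0, by simp, by simp⟩

theorem isFaceOf_filter {V : Finset M} {φ : Dual ℝ M} (h : ∀ x ∈ V, 0 ≤ φ x) :
    IsFaceOf (V.filter fun x => φ x = 0) V :=
  ⟨φ, h, by simp⟩

theorem mem_facesAbove {V E K : Finset M} {j : ℕ} :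
    K ∈ facesAbove V E j ↔ IsFaceOf K V ∧ E ⊆ K ∧ rk K = j := by
  simp only [facesAbove, mem_filter, mem_powerset, and_iff_right_iff_imp]
  exact fun h => h.1.subset

theorem mem_topFaces {V K : Finset M} {ψ : Dual ℝ M} {v : M} {j : ℕ} :
    K ∈ topFaces V ψ v j ↔
      IsFaceOf K V ∧ v ∈ K ∧ rk K = j ∧ ∀ x ∈ K, ψ x ≤ ψ v := by
  simp [topFaces, mem_facesAbove, and_assoc]

theorem mem_vertices {V : Finset M} {v : M} : v ∈ vertices V ↔ IsFaceOf {v} V := by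
  simp only [vertices, mem_filter, and_iff_right_iff_imp]
  exact fun h => h.subset (mem_singleton_self v)

theorem IsFaceOf.inter {A B V : Finset M} (hA : IsFaceOf A V) (hB : IsFaceOf B V) :
    IsFaceOf (A ∩ B) V := by
  obtain ⟨φ, hφ, hA⟩ := hA
  obtain ⟨ψ, hψ, hB⟩ := hB
  refine ⟨φ + ψ, fun x hx => add_nonneg (hφ x hx) (hψ x hx), fun x => ?_⟩
  rw [mem_inter, hA, hB, LinearMap.add_apply]
  constructor
  · rintro ⟨⟨hx, h1⟩, -, h2⟩
    exact ⟨hx, by rw [h1, h2, add_zero]⟩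
  · rintro ⟨hx, h⟩
    have h1 := hφ x hx
    have h2 := hψ x hx
    exact ⟨⟨hx, by linarith⟩, hx, by linarith⟩

theorem IsFaceOf.restrict {A B V : Finset M} (hB : IsFaceOf B V) (hBA : B ⊆ A) (hA : A ⊆ V) :
    IsFaceOf B A := by
  obtain ⟨φ, hφ, hB⟩ := hB
  exact ⟨φ, fun x hx => hφ x (hA hx), fun x =>
    ⟨fun h => ⟨hBA h, ((hB x).1 h).2⟩, fun h => (hB x).2 ⟨hA h.1, h.2⟩⟩⟩

theorem exists_pos_smul_add_pos (S : Finset M) (κ η : Dual ℝ M) (h : ∀ x ∈ S, 0 < κ x) :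
    ∃ c : ℝ, 0 < c ∧ ∀ x ∈ S, 0 < c * κ x + η x := by
  have h1 : ∀ᶠ c : ℝ in Filter.atTop, ∀ x ∈ S, 0 < c * κ x + η x := by
    refine (Filter.eventually_all_finset S).2 fun x hx => ?_
    filter_upwards [(Filter.tendsto_id.atTop_mul_const (h x hx)).eventually_gt_atTop (-η x)]
      with c hc
    simp only [id] at hc
    linarith
  exact ((Filter.eventually_gt_atTop 0).and h1).exists

theorem IsFaceOf.trans {A B V : Finset M} (hB : IsFaceOf B A) (hA : IsFaceOf A V) :
    IsFaceOf B V := by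
  obtain ⟨φ, hφ, hA⟩ := hA
  obtain ⟨ψ, hψ, hB⟩ := hB
  obtain ⟨c, hc, h⟩ := exists_pos_smul_add_pos (V.filter fun x => φ x ≠ 0) φ ψ fun x hx => by
    rw [mem_filter] at hx
    exact lt_of_le_of_ne (hφ x hx.1) hx.2.symm
  have key : ∀ x ∈ V, φ x ≠ 0 → 0 < c * φ x + ψ x := fun x hx h0 =>
    h x (mem_filter.2 ⟨hx, h0⟩)
  refine ⟨c • φ + ψ, fun x hx => ?_, fun x => ?_⟩
  · simp only [LinearMap.add_apply, LinearMap.smul_apply, smul_eq_mul]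
    by_cases h0 : φ x = 0
    · simpa [h0] using hψ x ((hA x).2 ⟨hx, h0⟩)
    · exact (key x hx h0).le
  · simp only [LinearMap.add_apply, LinearMap.smul_apply, smul_eq_mul]
    constructor
    · intro hx
      obtain ⟨hxA, h0⟩ := (hB x).1 hx
      obtain ⟨hxV, h1⟩ := (hA x).1 hxA
      exact ⟨hxV, by rw [h0, h1]; simp⟩
    · rintro ⟨hxV, h0⟩
      have h1 : φ x = 0 := by
        by_contra hne
        exact (key x hxV hne).ne' h0
      exact (hB x).2 ⟨(hA x).2 ⟨hxV, h1⟩, by simpa [h1] using h0⟩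

theorem IsFaceOf.mem_of_mem_span {A V : Finset M} (hA : IsFaceOf A V) {x : M} (hx : x ∈ V)
    (h : x ∈ span ℝ (A : Set M)) : x ∈ A := by
  obtain ⟨φ, -, hA⟩ := hA
  have : span ℝ (A : Set M) ≤ LinearMap.ker φ :=
    span_le.2 fun y hy => LinearMap.mem_ker.2 ((hA y).1 hy).2
  exact (hA x).2 ⟨hx, this h⟩

theorem rk_mono {A B : Finset M} (h : A ⊆ B) : rk A ≤ rk B :=
  finrank_mono (span_mono (coe_subset.2 h))

theorem IsFaceOf.rk_lt {A B V : Finset M} (hA : IsFaceOf A V) (hAB : A ⊂ B) (hB : B ⊆ V) :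
    rk A < rk B := by
  obtain ⟨x, hxB, hxA⟩ := exists_of_ssubset hAB
  refine finrank_lt_finrank_of_lt (lt_of_le_of_ne (span_mono (coe_subset.2 hAB.1)) fun h => ?_)
  exact hxA (hA.mem_of_mem_span (hB hxB) (h ▸ subset_span hxB))

theorem rk_le_of_subset_sup {A B : Finset M} {x : M}
    (h : (B : Set M) ⊆ (span ℝ (A : Set M) ⊔ span ℝ {x} : Submodule ℝ M)) :
    rk B ≤ rk A + 1 := by
  calc rk B ≤ finrank ℝ (span ℝ (A : Set M) ⊔ span ℝ {x} : Submodule ℝ M) :=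
        finrank_mono (span_le.2 h)
    _ ≤ finrank ℝ (span ℝ (A : Set M)) + finrank ℝ (span ℝ {x}) :=
        finrank_add_le_finrank_add_finrank _ _
    _ ≤ rk A + 1 := by
        have := finrank_span_le_card (R := ℝ) ({x} : Set M)
        simp only [Set.toFinset_singleton, card_singleton] at this
        exact Nat.add_le_add_left this _

/-- A feasible system of finitely many inequalities `c ≤ α x` has a solution for which the vectors
of the tight inequalities span. -/
theorem exists_tight_span (S : Finset (M × ℝ)) (α₀ : Dual ℝ M) (h₀ : ∀ s ∈ S, s.2 ≤ α₀ s.1) :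
    ∃ α : Dual ℝ M, (∀ s ∈ S, s.2 ≤ α s.1) ∧
      ∀ s ∈ S, s.1 ∈ span ℝ {x : M | (x, α x) ∈ S} := by
  induction hn : S.card - (S.filter fun s => α₀ s.1 = s.2).card using Nat.strong_induction_on
    generalizing α₀ with
  | _ n ih =>
    by_cases hs : ∀ s ∈ S, s.1 ∈ span ℝ {x : M | (x, α₀ x) ∈ S}
    · exact ⟨α₀, h₀, hs⟩
    push Not at hs
    obtain ⟨u, huS, hu⟩ := hs
    obtain ⟨η, hηT, hηu⟩ : ∃ η : Dual ℝ M,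
        (∀ x : M, (x, α₀ x) ∈ S → η x = 0) ∧ η u.1 < 0 := by
      obtain ⟨f, hf, hle⟩ := exists_le_ker_of_notMem hu
      have hT : ∀ x : M, (x, α₀ x) ∈ S → f x = 0 := fun x hx => hle (subset_span hx)
      rcases lt_or_gt_of_ne hf with h | h
      · exact ⟨f, hT, h⟩
      · exact ⟨-f, fun x hx => by simp [hT x hx], by simpa using h⟩
    obtain ⟨s₀, hs₀, hmin⟩ := exists_min_image (S.filter fun s => η s.1 < 0)
      (fun s => (α₀ s.1 - s.2) / (-η s.1)) ⟨u, mem_filter.2 ⟨huS, hηu⟩⟩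
    obtain ⟨hs₀S, hs₀η⟩ := mem_filter.1 hs₀
    set t := (α₀ s₀.1 - s₀.2) / (-η s₀.1) with ht
    have ht0 : 0 ≤ t := div_nonneg (sub_nonneg.2 (h₀ _ hs₀S)) (by linarith)
    have hfeas : ∀ s ∈ S, s.2 ≤ (α₀ + t • η) s.1 := by
      intro s hs
      simp only [LinearMap.add_apply, LinearMap.smul_apply, smul_eq_mul]
      rcases lt_or_ge (η s.1) 0 with h | h
      · have := hmin s (mem_filter.2 ⟨hs, h⟩)
        rw [le_div_iff₀ (by linarith)] at this
        linarith
      · have := h₀ s hs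
        have := mul_nonneg ht0 h
        linarith
    have hs₀' : (α₀ + t • η) s₀.1 = s₀.2 := by
      have : t * (-η s₀.1) = α₀ s₀.1 - s₀.2 := div_mul_cancel₀ _ (by linarith)
      simp only [LinearMap.add_apply, LinearMap.smul_apply, smul_eq_mul]
      linarith
    have hlt : (S.filter fun s => α₀ s.1 = s.2).card <
        (S.filter fun s => (α₀ + t • η) s.1 = s.2).card := by
      refine card_lt_card ((ssubset_iff_of_subset fun s hs => ?_).2
        ⟨s₀, mem_filter.2 ⟨hs₀S, hs₀'⟩, fun h => ?_⟩)
      · obtain ⟨hsS, hs⟩ := mem_filter.1 hs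
        have : η s.1 = 0 := hηT _ (by rw [hs]; exact hsS)
        exact mem_filter.2 ⟨hsS, by simp [this, hs]⟩
      · have : η s₀.1 = 0 := hηT _ (by rw [(mem_filter.1 h).2]; exact hs₀S)
        linarith
    have hle := card_filter_le S fun s => (α₀ + t • η) s.1 = s.2
    exact ih _ (by omega) (α₀ + t • η) hfeas rfl

/-- Every face not containing a vector `x` lies in a facet not containing `x`. -/
theorem IsFaceOf.exists_facet {K V : Finset M} (hK : IsFaceOf K V) {x : M} (hxV : x ∈ V)
    (hxK : x ∉ K) : ∃ F, IsFaceOf F V ∧ K ⊆ F ∧ x ∉ F ∧ rk F + 1 = rk V := by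
  obtain ⟨κ, hκ, hK⟩ := hK
  have hκx : 0 < κ x :=
    lt_of_le_of_ne (hκ x hxV) fun h => hxK ((hK x).2 ⟨hxV, h.symm⟩)
  set S : Finset (M × ℝ) := V.image (fun y => (y, (0 : ℝ))) ∪ K.image (fun y => (-y, (0 : ℝ)))
    ∪ {(x, (1 : ℝ))} with hS
  have memS : ∀ s : M × ℝ, s ∈ S ↔
      (s.1 ∈ V ∧ s.2 = 0) ∨ (-s.1 ∈ K ∧ s.2 = 0) ∨ (s.1 = x ∧ s.2 = 1) := by
    rintro ⟨y, r⟩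
    simp only [hS, mem_union, mem_image, mem_singleton, Prod.mk.injEq, or_assoc]
    refine or_congr ⟨?_, ?_⟩ (or_congr ⟨?_, ?_⟩ Iff.rfl)
    · rintro ⟨a, ha, rfl, rfl⟩; exact ⟨ha, rfl⟩
    · rintro ⟨ha, rfl⟩; exact ⟨y, ha, rfl, rfl⟩
    · rintro ⟨a, ha, rfl, rfl⟩; exact ⟨by simpa using ha, rfl⟩
    · rintro ⟨ha, rfl⟩; exact ⟨-y, ha, by simp, rfl⟩
  obtain ⟨α, hα, hspan⟩ := exists_tight_span S ((κ x)⁻¹ • κ) fun s hs => by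
    simp only [LinearMap.smul_apply, smul_eq_mul]
    rcases (memS s).1 hs with ⟨h, h0⟩ | ⟨h, h0⟩ | ⟨h, h0⟩
    · rw [h0]; exact mul_nonneg (inv_nonneg.2 hκx.le) (hκ _ h)
    · have := ((hK _).1 h).2
      rw [map_neg, neg_eq_zero] at this
      rw [h0, this, mul_zero]
    · rw [h0, h, inv_mul_cancel₀ hκx.ne']
  have hαV : ∀ y ∈ V, 0 ≤ α y := fun y hy => hα (y, 0) ((memS _).2 (Or.inl ⟨hy, rfl⟩))
  have hαK : ∀ y ∈ K, α y = 0 := fun y hy => by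
    have h1 := hα (-y, 0) ((memS _).2 (Or.inr (Or.inl ⟨by simpa using hy, rfl⟩)))
    have h2 := hαV y ((hK y).1 hy).1
    simp only [map_neg] at h1
    linarith
  have hαx : 1 ≤ α x := hα (x, 1) ((memS _).2 (Or.inr (Or.inr ⟨rfl, rfl⟩)))
  have hF := isFaceOf_filter hαV
  set F := V.filter fun y => α y = 0 with hFdef
  have hxF : x ∉ F := fun h => by
    have := (mem_filter.1 h).2
    linarith
  have hKF : K ⊆ F := fun y hy => mem_filter.2 ⟨((hK y).1 hy).1, hαK y hy⟩
  refine ⟨F, hF, hKF, hxF, le_antisymm ?_ ?_⟩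
  · exact hF.rk_lt ⟨hF.subset, fun h => hxF (h hxV)⟩ Subset.rfl
  · refine rk_le_of_subset_sup (x := x) fun y hy => ?_
    have := hspan (y, 0) ((memS _).2 (Or.inl ⟨hy, rfl⟩))
    refine (span_le.2 fun z hz => ?_ : span ℝ {y : M | (y, α y) ∈ S} ≤ _) this
    rcases (memS _).1 hz with ⟨h, h0⟩ | ⟨h, h0⟩ | ⟨h, h0⟩
    · exact mem_sup_left (subset_span (mem_filter.2 ⟨h, h0⟩))
    · have h1 := mem_sup_left (T := span ℝ {x}) (subset_span (R := ℝ) (coe_subset.2 hKF h))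
      simpa using neg_mem h1
    · rw [show z = x from h]
      exact mem_sup_right (mem_span_singleton_self x)

theorem exists_smul_le (K : Finset M) (φ κ : Dual ℝ M) {w : M} (hw : w ∈ K) (hφw : 0 < φ w)
    (hφ : ∀ x ∈ K, 0 ≤ φ x) (hκ : ∀ x ∈ K, 0 ≤ κ x) :
    ∃ t : ℝ, (∀ x ∈ K, t * φ x ≤ κ x) ∧ ∃ w₀ ∈ K, 0 < φ w₀ ∧ κ w₀ = t * φ w₀ := by
  obtain ⟨w₀, hw₀, hmin⟩ := exists_min_image (K.filter fun x => 0 < φ x)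
    (fun x => κ x / φ x) ⟨w, mem_filter.2 ⟨hw, hφw⟩⟩
  obtain ⟨hw₀K, hw₀φ⟩ := mem_filter.1 hw₀
  refine ⟨κ w₀ / φ w₀, fun x hx => ?_, w₀, hw₀K, hw₀φ, (div_mul_cancel₀ _ hw₀φ.ne').symm⟩
  rcases (hφ x hx).eq_or_lt with h | h
  · rw [← h, mul_zero]
    exact hκ x hx
  · exact (le_div_iff₀ h).1 (hmin x (mem_filter.2 ⟨hx, h⟩))

/-- Every face contained in a proper face `F` is covered by a face meeting `F` in it. -/
theorem IsFaceOf.exists_cover {E F V : Finset M} (hE : IsFaceOf E V) (hF : IsFaceOf F V)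
    (hEF : E ⊆ F) (hFV : F ≠ V) :
    ∃ K, IsFaceOf K V ∧ K ∩ F = E ∧ rk K = rk E + 1 := by
  have hVF : ¬ V ⊆ F := fun h => hFV (hF.subset.antisymm h)
  obtain ⟨K, hK, hmin⟩ := exists_min_image
    (V.powerset.filter fun K => IsFaceOf K V ∧ E ⊆ K ∧ ¬ K ⊆ F) card
    ⟨V, by simp [IsFaceOf.refl, hE.subset, hVF]⟩
  simp only [mem_filter, mem_powerset] at hK hmin
  obtain ⟨hKV, hK, hEK, hKF⟩ := hK
  have hlt : rk E < rk K := hE.rk_lt ⟨hEK, fun h => hKF (h.trans hEF)⟩ hKV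
  obtain ⟨w, hwK, hwF⟩ := not_subset.1 hKF
  have hEK' := hE.restrict hEK hKV
  obtain ⟨φ, hφ, hFφ⟩ := hF
  obtain ⟨κ, hκ, hEκ⟩ := hE
  have hφw : 0 < φ w :=
    lt_of_le_of_ne (hφ w (hKV hwK)) fun h => hwF ((hFφ w).2 ⟨hKV hwK, h.symm⟩)
  have hφE : ∀ x ∈ E, φ x = 0 := fun x hx => ((hFφ x).1 (hEF hx)).2
  have prop : ∀ θ : Dual ℝ M, (∀ x ∈ K, 0 ≤ θ x) → (∀ x ∈ E, θ x = 0) →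
      ∃ t, ∀ x ∈ K, θ x = t * φ x := by
    intro θ hθ hθE
    obtain ⟨t, ht, w₀, hw₀, hφw₀, htw₀⟩ :=
      exists_smul_le K φ θ hwK hφw (fun x hx => hφ x (hKV hx)) hθ
    have hL := isFaceOf_filter (V := K) (φ := θ - t • φ) fun x hx => by
      simpa using ht x hx
    have hle := hmin _ ⟨hL.subset.trans hKV, hL.trans hK, fun x hx => mem_filter.2
      ⟨hEK hx, by simp [hθE x hx, hφE x hx]⟩, fun h => hφw₀.ne'
        ((hFφ w₀).1 (h (mem_filter.2 ⟨hw₀, by simp [htw₀]⟩))).2⟩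
    have heq := eq_of_subset_of_card_le hL.subset hle
    refine ⟨t, fun x hx => ?_⟩
    rw [← heq] at hx
    have := (mem_filter.1 hx).2
    simpa [sub_eq_zero] using this
  have hle : rk K ≤ rk E + 1 := by
    refine rk_le_of_subset_sup (x := w) fun u hu => ?_
    by_contra hnot
    obtain ⟨η, hηu, hη⟩ := exists_le_ker_of_notMem hnot
    have hηE : ∀ x ∈ E, η x = 0 := fun x hx => hη (mem_sup_left (subset_span hx))
    have hηw : η w = 0 := hη (mem_sup_right (mem_span_singleton_self w))
    obtain ⟨c, hc, hpos⟩ := exists_pos_smul_add_pos (K.filter fun x => x ∉ E) κ η fun x hx => by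
      obtain ⟨hxK, hxE⟩ := mem_filter.1 hx
      exact lt_of_le_of_ne (hκ x (hKV hxK)) fun h => hxE ((hEκ x).2 ⟨hKV hxK, h.symm⟩)
    have hκE : ∀ x ∈ E, κ x = 0 := fun x hx => ((hEκ x).1 hx).2
    obtain ⟨t, ht⟩ := prop κ (fun x hx => hκ x (hKV hx)) hκE
    obtain ⟨s, hs⟩ := prop (c • κ + η) (fun x hx => by
      simp only [LinearMap.add_apply, LinearMap.smul_apply, smul_eq_mul]
      by_cases hxE : x ∈ E
      · simp [hκE x hxE, hηE x hxE]
      · exact (hpos x (mem_filter.2 ⟨hx, hxE⟩)).le) fun x hx => by simp [hκE x hx, hηE x hx]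
    simp only [LinearMap.add_apply, LinearMap.smul_apply, smul_eq_mul] at hs
    have h1 := hs w hwK
    rw [ht w hwK, hηw, add_zero, ← mul_assoc] at h1
    have h2 := hs u hu
    rw [ht u hu, ← mul_right_cancel₀ hφw.ne' h1] at h2
    exact hηu (by linarith)
  refine ⟨K, hK, ?_, by omega⟩
  have hKF' : IsFaceOf (K ∩ F) V := hK.inter ⟨φ, hφ, hFφ⟩
  have h1 : rk (K ∩ F) < rk K :=
    hKF'.rk_lt ⟨inter_subset_left, fun h => hwF (mem_inter.1 (h hwK)).2⟩ hKV
  by_contra hne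
  have h2 : rk E < rk (K ∩ F) := IsFaceOf.rk_lt ⟨κ, hκ, hEκ⟩
    ((subset_inter hEK hEF).ssubset_of_ne (Ne.symm hne)) hKF'.subset
  omega

theorem facesAbove_mono {F V E : Finset M} (hF : IsFaceOf F V) (j : ℕ) :
    facesAbove F E j ⊆ facesAbove V E j := fun K hK => by
  rw [mem_facesAbove] at hK ⊢
  exact ⟨hK.1.trans hF, hK.2⟩

/-- The interval above a face of corank `n` has at least as many elements of each rank as the
Boolean lattice of rank `n`. -/
theorem choose_le_card_facesAbove {n : ℕ} {E V : Finset M} (hE : IsFaceOf E V)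
    (hn : rk V = rk E + n) (k : ℕ) : n.choose k ≤ (facesAbove V E (rk E + k)).card := by
  induction n generalizing V k with
  | zero =>
    rcases k with _ | k
    · rw [Nat.choose_zero_right]
      exact card_pos.2 ⟨E, mem_facesAbove.2 ⟨hE, Subset.rfl, rfl⟩⟩
    · simp
  | succ n ih =>
    rcases k with _ | k
    · rw [Nat.choose_zero_right]
      exact card_pos.2 ⟨E, mem_facesAbove.2 ⟨hE, Subset.rfl, rfl⟩⟩
    have hVE : ¬ V ⊆ E := fun h => by
      have := rk_mono h
      omega
    obtain ⟨x, hxV, hxE⟩ := not_subset.1 hVE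
    obtain ⟨F, hF, hEF, hxF, hrF⟩ := hE.exists_facet hxV hxE
    have hFV : F ≠ V := fun h => hxF (h ▸ hxV)
    have hEF' := hE.restrict hEF hF.subset
    have h1 := ih hEF' (by omega) k
    have h2 := ih hEF' (by omega) (k + 1)
    have hcov : ∀ K ∈ facesAbove F E (rk E + k), ∃ L, IsFaceOf L V ∧ L ∩ F = K ∧
        rk L = rk K + 1 := fun K hK =>
      (((mem_facesAbove.1 hK).1).trans hF).exists_cover hF (mem_facesAbove.1 hK).1.subset hFV
    choose! c hc using hcov
    have hinj : Set.InjOn c (facesAbove F E (rk E + k)) := fun K hK L hL h => by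
      rw [← (hc K hK).2.1, h, (hc L hL).2.1]
    have hdisj : Disjoint ((facesAbove F E (rk E + k)).image c)
        (facesAbove F E (rk E + (k + 1))) := by
      rw [disjoint_left]
      intro L hL hLF
      obtain ⟨K, hK, rfl⟩ := mem_image.1 hL
      have h3 := (hc K hK).2.1
      rw [inter_eq_left.2 (mem_facesAbove.1 hLF).1.subset] at h3
      have h4 := (hc K hK).2.2
      rw [h3] at h4
      omega
    rw [Nat.choose_succ_succ]
    calc n.choose k + n.choose (k + 1)
        ≤ ((facesAbove F E (rk E + k)).image c ∪ facesAbove F E (rk E + (k + 1))).card := by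
          rw [card_union_of_disjoint hdisj, card_image_of_injOn hinj]
          exact Nat.add_le_add h1 h2
      _ ≤ _ := by
          refine card_le_card (union_subset (fun L hL => ?_) (facesAbove_mono hF _))
          obtain ⟨K, hK, rfl⟩ := mem_image.1 hL
          obtain ⟨h3, h4, h5⟩ := hc K hK
          obtain ⟨-, h6, h7⟩ := mem_facesAbove.1 hK
          refine mem_facesAbove.2 ⟨h3, h6.trans (h4.symm.subset.trans inter_subset_left),
            by omega⟩

/-- At a vertex, a linear functional is nonpositive on one face and nonnegative on another, and
the ranks of these two faces are complementary. -/
theorem exists_complementary_faces {V : Finset M} {v : M} (hv : IsFaceOf {v} V) (hv0 : v ≠ 0)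
    (ψ : Dual ℝ M) (hψ : ψ v = 0) :
    ∃ A B, IsFaceOf A V ∧ IsFaceOf B V ∧ v ∈ A ∧ v ∈ B ∧ (∀ x ∈ A, ψ x ≤ 0) ∧
      (∀ x ∈ B, 0 ≤ ψ x) ∧ rk V + 1 ≤ rk A + rk B := by
  have hvV : v ∈ V := hv.subset (mem_singleton_self v)
  obtain ⟨κ, hκ, hvκ⟩ := hv
  have hκv : κ v = 0 := ((hvκ v).1 (mem_singleton_self v)).2
  obtain ⟨c, hc, hpos⟩ := exists_pos_smul_add_pos (V.filter fun x => x ≠ v) κ (-ψ) fun x hx => by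
    obtain ⟨hxV, hxv⟩ := mem_filter.1 hx
    exact lt_of_le_of_ne (hκ x hxV) fun h => hxv (mem_singleton.1 ((hvκ x).2 ⟨hxV, h.symm⟩))
  set S : Finset (M × ℝ) := V.image (fun y => (y, (0 : ℝ))) ∪ V.image (fun y => (y, ψ y))
    ∪ {(-v, (0 : ℝ))} with hS
  have memS : ∀ s : M × ℝ, s ∈ S ↔
      (s.1 ∈ V ∧ s.2 = 0) ∨ (s.1 ∈ V ∧ s.2 = ψ s.1) ∨ (s.1 = -v ∧ s.2 = 0) := by
    rintro ⟨y, r⟩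
    simp only [hS, mem_union, mem_image, mem_singleton, Prod.mk.injEq, or_assoc]
    refine or_congr ⟨?_, ?_⟩ (or_congr ⟨?_, ?_⟩ Iff.rfl)
    · rintro ⟨a, ha, rfl, rfl⟩; exact ⟨ha, rfl⟩
    · rintro ⟨ha, rfl⟩; exact ⟨y, ha, rfl, rfl⟩
    · rintro ⟨a, ha, rfl, rfl⟩; exact ⟨ha, rfl⟩
    · rintro ⟨ha, rfl⟩; exact ⟨y, ha, rfl, rfl⟩
  obtain ⟨α, hα, hspan⟩ := exists_tight_span S (c • κ) fun s hs => by
    simp only [LinearMap.smul_apply, smul_eq_mul]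
    rcases (memS s).1 hs with ⟨h, h0⟩ | ⟨h, h0⟩ | ⟨h, h0⟩
    · rw [h0]; exact mul_nonneg hc.le (hκ _ h)
    · rw [h0]
      by_cases hsv : s.1 = v
      · simp [hsv, hψ, hκv]
      · have := hpos s.1 (mem_filter.2 ⟨h, hsv⟩)
        rw [LinearMap.neg_apply] at this
        linarith
    · simp [h0, h, hκv]
  have hαV : ∀ y ∈ V, 0 ≤ α y := fun y hy => hα (y, 0) ((memS _).2 (Or.inl ⟨hy, rfl⟩))
  have hαψ : ∀ y ∈ V, ψ y ≤ α y := fun y hy =>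
    hα (y, ψ y) ((memS _).2 (Or.inr (Or.inl ⟨hy, rfl⟩)))
  have hαv : α v = 0 := by
    have h1 := hα (-v, 0) ((memS _).2 (Or.inr (Or.inr ⟨rfl, rfl⟩)))
    simp only [map_neg] at h1
    linarith [hαV v hvV]
  have hA := isFaceOf_filter hαV
  have hB := isFaceOf_filter (V := V) (φ := α - ψ) fun y hy => by simpa using hαψ y hy
  set A := V.filter fun y => α y = 0
  set B := V.filter fun y => (α - ψ) y = 0
  have hvA : v ∈ A := mem_filter.2 ⟨hvV, hαv⟩
  have hvB : v ∈ B := mem_filter.2 ⟨hvV, by simp [hαv, hψ]⟩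
  refine ⟨A, B, hA, hB, hvA, hvB, fun x hx => ?_, fun x hx => ?_, ?_⟩
  · obtain ⟨hxV, h⟩ := mem_filter.1 hx
    linarith [hαψ x hxV]
  · obtain ⟨hxV, h⟩ := mem_filter.1 hx
    rw [LinearMap.sub_apply] at h
    linarith [hαV x hxV]
  · have hsup : rk V ≤ finrank ℝ (span ℝ (A : Set M) ⊔ span ℝ (B : Set M) : Submodule ℝ M) := by
      refine finrank_mono (span_le.2 fun y hy => ?_)
      have := hspan (y, 0) ((memS _).2 (Or.inl ⟨hy, rfl⟩))
      refine (span_le.2 fun z hz => ?_ : span ℝ {y : M | (y, α y) ∈ S} ≤ _) this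
      rcases (memS _).1 hz with ⟨h, h0⟩ | ⟨h, h0⟩ | ⟨h, h0⟩
      · exact mem_sup_left (subset_span (mem_filter.2 ⟨h, h0⟩))
      · exact mem_sup_right (subset_span (mem_filter.2 ⟨h, by simpa [sub_eq_zero] using h0⟩))
      · rw [show z = -v from h]
        exact neg_mem (mem_sup_left (subset_span hvA))
    have hinf : 1 ≤ finrank ℝ (span ℝ (A : Set M) ⊓ span ℝ (B : Set M) : Submodule ℝ M) := by
      refine one_le_finrank_iff.2 fun h => hv0 ?_
      exact (mem_bot ℝ).1 (h ▸ ⟨subset_span hvA, subset_span hvB⟩)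
    have := finrank_sup_add_finrank_inf_eq (span ℝ (A : Set M)) (span ℝ (B : Set M))
    unfold rk at hsup ⊢
    omega

theorem choose_add_choose_le_of_add (k : ℕ) {p q n : ℕ} (h : p + q = n) :
    ((n + 1) / 2).choose k + (n / 2).choose k ≤ p.choose k + q.choose k := by
  wlog hpq : p ≤ q generalizing p q
  · rw [add_comm (p.choose k)]
    exact this (by omega) (by omega)
  induction hm : q - p using Nat.strong_induction_on generalizing p q with
  | _ m ih =>
    by_cases hlt : q ≤ p + 1
    · have h1 : (n + 1) / 2 = q := by omega
      have h2 : n / 2 = p := by omega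
      rw [h1, h2, add_comm]
    · obtain ⟨r, rfl⟩ : ∃ r, q = r + 1 := ⟨q - 1, by omega⟩
      refine (ih (r - (p + 1)) (by omega) (by omega : (p + 1) + r = n) (by omega) rfl).trans ?_
      rcases k with _ | k
      · simp
      · have := Nat.choose_le_choose k (by omega : p ≤ r)
        rw [Nat.choose_succ_succ', Nat.choose_succ_succ' r k]
        omega

theorem choose_add_choose_le {k p q d : ℕ} (h : d ≤ p + q) :
    ((d + 1) / 2).choose k + (d / 2).choose k ≤ p.choose k + q.choose k :=
  (Nat.add_le_add (Nat.choose_le_choose k (by omega)) (Nat.choose_le_choose k (by omega))).trans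
    (choose_add_choose_le_of_add k (rfl : p + q = p + q))

theorem choose_add_choose_lt {a b k : ℕ} (ha : 1 ≤ a) (hb : 1 ≤ b) (hk : 2 ≤ k)
    (hkab : k ≤ a + b) : a.choose k + b.choose k < (a + b).choose k := by
  obtain ⟨k, rfl⟩ : ∃ j, k = j + 1 := ⟨k - 1, by omega⟩
  induction b, hb using Nat.le_induction with
  | base =>
    rw [Nat.choose_succ_succ' a k, Nat.choose_eq_zero_of_lt (by omega : 1 < k + 1)]
    have := Nat.choose_pos (by omega : k ≤ a)
    omega
  | succ b hb ih =>
    rw [← add_assoc, Nat.choose_succ_succ' (a + b) k, Nat.choose_succ_succ' b k]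
    rcases (by omega : k + 1 ≤ a + b ∨ k = a + b) with h | h
    · have := ih h
      have := Nat.choose_le_choose k (by omega : b ≤ a + b)
      omega
    · rw [Nat.choose_eq_zero_of_lt (by omega : a < k + 1),
        Nat.choose_eq_zero_of_lt (by omega : b < k + 1),
        Nat.choose_eq_zero_of_lt (by omega : b < k)]
      have := Nat.choose_pos (by omega : k ≤ a + b)
      omega

theorem card_le_card_of_missing {α β : Type*} (X : Finset α) (Y : Finset β) (R : α → β → Prop)
    [∀ x y, Decidable (R x y)]
    (h₁ : ∀ y ∈ Y, ∃ x ∈ X, ¬ R x y) (h₂ : ∀ y ∈ Y, X.card ≤ (X.filter (R · y)).card + 1)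
    (h₃ : ∀ y ∈ Y, ∀ z ∈ Y, (∀ x ∈ X, R x y ↔ R x z) → y = z) : Y.card ≤ X.card := by
  rcases Y.eq_empty_or_nonempty with rfl | ⟨y₀, hy₀⟩
  · simp
  have : Nonempty α := ⟨(h₁ y₀ hy₀).choose⟩
  choose! f hfX hfR using h₁
  have key : ∀ y ∈ Y, X.filter (R · y) = X.erase (f y) := fun y hy =>
    eq_of_subset_of_card_le (fun x hx => mem_erase.2
      ⟨fun h => hfR y hy (h ▸ (mem_filter.1 hx).2), (mem_filter.1 hx).1⟩) (by
        rw [card_erase_of_mem (hfX y hy)]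
        have := h₂ y hy
        omega)
  refine card_le_card_of_injOn f hfX fun y hy z hz h => h₃ y hy z hz fun x hx => ?_
  have h4 : X.filter (R · y) = X.filter (R · z) := by rw [key y hy, key z hz, h]
  have h5 := Finset.ext_iff.1 h4 x
  simpa [hx] using h5

theorem rk_singleton {v : M} (hv : v ≠ 0) : rk {v} = 1 := by
  rw [rk, coe_singleton, finrank_span_singleton hv]

theorem rk_empty : rk (∅ : Finset M) = 0 := by
  rw [rk, coe_empty, span_empty, finrank_bot]

theorem nonempty_of_rk_ne_zero {A : Finset M} (hA : rk A ≠ 0) : A.Nonempty := by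
  rw [nonempty_iff_ne_empty]
  rintro rfl
  exact hA rk_empty

section Normalized

variable {V : Finset M} {h ψ : Dual ℝ M} {d k : ℕ} (hV : ∀ x ∈ V, h x = 1)
include hV

theorem ne_zero_of_mem {v : M} (hv : v ∈ V) : v ≠ 0 := by
  rintro rfl
  simpa using hV 0 hv

theorem rk_singleton_of_mem {v : M} (hv : v ∈ V) : rk {v} = 1 :=
  rk_singleton (ne_zero_of_mem hV hv)

theorem isFaceOf_singleton_of_forall_le (hψ : Set.InjOn ψ V) {A : Finset M} (hA : A ⊆ V) {v : M}
    (hv : v ∈ A) (hmax : ∀ x ∈ A, ψ x ≤ ψ v) : IsFaceOf {v} A := by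
  refine ⟨ψ v • h - ψ, fun x hx => ?_, fun x => ?_⟩
  · simpa [hV x (hA hx)] using hmax x hx
  · rw [mem_singleton]
    constructor
    · rintro rfl
      exact ⟨hv, by simp [hV x (hA hv)]⟩
    · rintro ⟨hx, h0⟩
      refine hψ (hA hx) (hA hv) ?_
      simp only [LinearMap.sub_apply, LinearMap.smul_apply, smul_eq_mul, hV x (hA hx)] at h0
      linarith

theorem eq_singleton_of_rk_eq_one {A : Finset M} (hA : A ⊆ V) (h1 : rk A = 1) :
    ∃ v ∈ A, A = {v} := by
  obtain ⟨v, hv⟩ := nonempty_of_rk_ne_zero (by omega : rk A ≠ 0)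
  refine ⟨v, hv, eq_singleton_iff_unique_mem.2 ⟨hv, fun x hx => ?_⟩⟩
  have hle : span ℝ {v} ≤ span ℝ (A : Set M) := span_mono (by simpa using hv)
  have hv0 := ne_zero_of_mem hV (hA hv)
  have heq := eq_of_le_of_finrank_eq hle (by rw [finrank_span_singleton hv0]; exact h1.symm)
  have hx' : x ∈ span ℝ {v} := heq ▸ subset_span hx
  obtain ⟨c, rfl⟩ := mem_span_singleton.1 hx'
  have := hV _ (hA hx)
  rw [map_smul, hV v (hA hv), smul_eq_mul, mul_one] at this
  rw [this, one_smul]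

theorem card_vertices : (facesAbove V ∅ 1).card = (vertices V).card := by
  symm
  refine card_bij (fun v _ => {v}) (fun v hv => ?_) (fun v _ w _ h => singleton_injective h)
    fun A hA => ?_
  · have hv' := mem_vertices.1 hv
    exact mem_facesAbove.2 ⟨hv', empty_subset _,
      rk_singleton_of_mem hV (hv'.subset (mem_singleton_self v))⟩
  · obtain ⟨hAV, -, h1⟩ := mem_facesAbove.1 hA
    obtain ⟨v, hv, rfl⟩ := eq_singleton_of_rk_eq_one hV hAV.subset h1
    exact ⟨v, mem_vertices.2 hAV, rfl⟩

/-- Every face has a unique element, which is a vertex, at which `ψ` is maximal. -/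
theorem card_facesAbove_eq_sum (hψ : Set.InjOn ψ V) (k : ℕ) :
    (facesAbove V ∅ (k + 1)).card = ∑ v ∈ vertices V, (topFaces V ψ v (k + 1)).card := by
  rw [← card_biUnion]
  · congr 1
    ext A
    simp only [mem_biUnion, mem_topFaces, mem_facesAbove, empty_subset, true_and]
    constructor
    · rintro ⟨hA, hr⟩
      obtain ⟨v, hv, hmax⟩ :=
        exists_max_image A ψ (nonempty_of_rk_ne_zero (by omega : rk A ≠ 0))
      exact ⟨v, mem_vertices.2
        ((isFaceOf_singleton_of_forall_le hV hψ hA.subset hv hmax).trans hA), hA, hv, hr, hmax⟩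
    · rintro ⟨v, -, hA, -, hr, -⟩
      exact ⟨hA, hr⟩
  · intro v _ w _ hvw
    refine disjoint_left.2 fun A hA hA' => hvw ?_
    obtain ⟨hAV, hv, -, hv'⟩ := mem_topFaces.1 hA
    obtain ⟨-, hw, -, hw'⟩ := mem_topFaces.1 hA'
    exact hψ (hAV.subset hv) (hAV.subset hw) (le_antisymm (hw' v hv) (hv' w hw))

theorem choose_le_card_facesAbove_vertex {A : Finset M} (hA : IsFaceOf A V) {v : M}
    (hv : IsFaceOf {v} V) (hvA : v ∈ A) (k : ℕ) :
    (rk A - 1).choose k ≤ (facesAbove A {v} (k + 1)).card := by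
  have hr := rk_singleton_of_mem hV (hA.subset hvA)
  have hvA' := hv.restrict (singleton_subset_iff.2 hvA) hA.subset
  have := rk_mono hvA'.subset
  have := choose_le_card_facesAbove (n := rk A - 1) hvA' (by omega) k
  rwa [hr, add_comm 1 k] at this

theorem choose_add_choose_le_card_topFaces (hd : rk V = d + 1) {v : M} (hv : IsFaceOf {v} V)
    (ψ : Dual ℝ M) (k : ℕ) :
    ((d + 1) / 2).choose k + (d / 2).choose k ≤
      (topFaces V ψ v (k + 1)).card + (topFaces V (-ψ) v (k + 1)).card := by
  have hvV := hv.subset (mem_singleton_self v)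
  obtain ⟨A, B, hA, hB, hvA, hvB, hψA, hψB, hr⟩ := exists_complementary_faces hv
    (ne_zero_of_mem hV hvV) (ψ - ψ v • h) (by simp [hV v hvV])
  refine (choose_add_choose_le (p := rk A - 1) (q := rk B - 1) (by omega)).trans
    (Nat.add_le_add ?_ ?_)
  · refine (choose_le_card_facesAbove_vertex hV hA hv hvA k).trans (card_le_card fun K hK => ?_)
    obtain ⟨hKA, hvK, hr⟩ := mem_facesAbove.1 hK
    refine mem_topFaces.2 ⟨hKA.trans hA, by simpa using hvK, hr, fun x hx => ?_⟩
    simpa [hV x (hA.subset (hKA.subset hx))] using hψA x (hKA.subset hx)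
  · refine (choose_le_card_facesAbove_vertex hV hB hv hvB k).trans (card_le_card fun K hK => ?_)
    obtain ⟨hKB, hvK, hr⟩ := mem_facesAbove.1 hK
    refine mem_topFaces.2 ⟨hKB.trans hB, by simpa using hvK, hr, fun x hx => ?_⟩
    simpa [hV x (hB.subset (hKB.subset hx))] using hψB x (hKB.subset hx)

theorem mul_card_lt_two_mul_card (hψ : Set.InjOn ψ V) (hd : rk V = d + 1) (hk : 2 ≤ k)
    (hkd : k ≤ d) :
    (((d + 1) / 2).choose k + (d / 2).choose k) * (facesAbove V ∅ 1).card <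
      2 * (facesAbove V ∅ (k + 1)).card := by
  have hψ' : Set.InjOn (-ψ) V := fun x hx y hy hxy => hψ hx hy (neg_injective hxy)
  rw [card_vertices hV, two_mul]
  nth_rw 1 [card_facesAbove_eq_sum hV hψ]
  rw [card_facesAbove_eq_sum hV hψ', ← sum_add_distrib, mul_comm, ← smul_eq_mul,
    ← sum_const]
  obtain ⟨v, hvV, hmin⟩ :=
    exists_max_image V (-ψ) (nonempty_of_rk_ne_zero (by omega : rk V ≠ 0))
  have hv := isFaceOf_singleton_of_forall_le hV hψ' Subset.rfl hvV hmin
  refine sum_lt_sum (fun w hw =>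
    choose_add_choose_le_card_topFaces hV hd (mem_vertices.1 hw) ψ k) ⟨v, mem_vertices.2 hv, ?_⟩
  have h1 := choose_add_choose_lt (a := (d + 1) / 2) (b := d / 2) (by omega) (by omega) hk
    (by omega)
  rw [show (d + 1) / 2 + d / 2 = d by omega] at h1
  have h2 := choose_le_card_facesAbove_vertex hV (IsFaceOf.refl V) hv hvV k
  rw [hd, Nat.add_sub_cancel] at h2
  have h3 : facesAbove V {v} (k + 1) ⊆ topFaces V (-ψ) v (k + 1) := fun K hK => by
    obtain ⟨hKV, hvK, hr⟩ := mem_facesAbove.1 hK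
    exact mem_topFaces.2 ⟨hKV, by simpa using hvK, hr, fun x hx => hmin x (hKV.subset hx)⟩
  have h4 := card_le_card h3
  omega

/-- A vertex contained in an edge is one of its two ends. -/
theorem topFaces_union_eq (hψ : Set.InjOn ψ V) {v : M} (hv : IsFaceOf {v} V) :
    (topFaces V ψ v 2).card + (topFaces V (-ψ) v 2).card = (facesAbove V {v} 2).card := by
  rw [← card_union_of_disjoint]
  · congr 1
    ext K
    simp only [mem_union, mem_topFaces, mem_facesAbove, singleton_subset_iff,
      LinearMap.neg_apply, neg_le_neg_iff]
    constructor
    · rintro (⟨h1, h2, h3, -⟩ | ⟨h1, h2, h3, -⟩) <;> exact ⟨h1, h2, h3⟩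
    · rintro ⟨hK, hvK, hr⟩
      by_contra hcon
      simp only [hK, hvK, hr, true_and, not_or, not_forall, not_le] at hcon
      obtain ⟨⟨t, htK, ht⟩, b, hbK, hb⟩ := hcon
      have hKV := hK.subset
      have hli : LinearIndependent ℝ ![t, b] := by
        rw [LinearIndependent.pair_iff]
        intro s r hsr
        have h1 := congrArg h hsr
        have h2 := congrArg ψ hsr
        simp only [map_add, map_smul, smul_eq_mul, map_zero, hV t (hKV htK),
          hV b (hKV hbK), mul_one] at h1 h2
        have h3 : s * (ψ t - ψ b) = 0 := by
          linear_combination h2 - ψ b * h1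
        have h4 : s = 0 := (mul_eq_zero.1 h3).resolve_right (by linarith)
        exact ⟨h4, by linarith⟩
      have hsp : span ℝ (Set.range ![t, b]) = span ℝ (K : Set M) := by
        refine eq_of_le_of_finrank_eq (span_mono ?_) ?_
        · rintro x ⟨i, rfl⟩
          fin_cases i
          · exact htK
          · exact hbK
        · rw [finrank_span_eq_card hli]
          exact hr.symm
      have hvsp : v ∈ span ℝ (Set.range ![t, b]) := hsp ▸ subset_span hvK
      rw [Matrix.range_cons, Matrix.range_cons, Matrix.range_empty, Set.union_empty,
        Set.singleton_union, mem_span_pair] at hvsp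
      obtain ⟨s, r, hsr⟩ := hvsp
      have h1 := congrArg h hsr
      have h2 := congrArg ψ hsr
      simp only [map_add, map_smul, smul_eq_mul, hV t (hKV htK),
        hV b (hKV hbK), hV v (hKV hvK), mul_one] at h1 h2
      have hs : 0 < s := by
        have : 0 < s * (ψ t - ψ b) := by
          have : s * (ψ t - ψ b) = ψ v - ψ b := by linear_combination h2 - ψ b * h1
          linarith
        exact pos_of_mul_pos_left this (by linarith)
      have hr0 : 0 < r := by
        have : 0 < r * (ψ t - ψ b) := by
          have : r * (ψ t - ψ b) = ψ t - ψ v := by linear_combination ψ t * h1 - h2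
          linarith
        exact pos_of_mul_pos_left this (by linarith)
      obtain ⟨κ, hκ, hvκ⟩ := hv
      have h3 := congrArg κ hsr
      rw [map_add, map_smul, map_smul, ((hvκ v).1 (mem_singleton_self v)).2] at h3
      have h4 := mul_nonneg hs.le (hκ t (hKV htK))
      have h5 := mul_nonneg hr0.le (hκ b (hKV hbK))
      simp only [smul_eq_mul] at h3
      have h6 : κ t = 0 := (mul_eq_zero.1 (by linarith : s * κ t = 0)).resolve_left hs.ne'
      have h7 := mem_singleton.1 ((hvκ t).2 ⟨hKV htK, h6⟩)
      rw [h7] at ht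
      exact lt_irrefl _ ht
  · refine disjoint_left.2 fun K hK hK' => ?_
    obtain ⟨hKV, hvK, hr, h1⟩ := mem_topFaces.1 hK
    obtain ⟨-, -, -, h2⟩ := mem_topFaces.1 hK'
    have : K = {v} := eq_singleton_iff_unique_mem.2 ⟨hvK, fun x hx =>
      hψ (hKV.subset hx) (hKV.subset hvK) (le_antisymm (h1 x hx) (by simpa using h2 x hx))⟩
    rw [this, rk_singleton_of_mem hV (hKV.subset hvK)] at hr
    omega

/-- A vertex lies in exactly `d` edges if and only if it lies in exactly `d` facets. -/
theorem card_edges_eq_iff_card_facets_eq (hd : rk V = d + 1) (hd2 : 2 ≤ d) {v : M}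
    (hv : IsFaceOf {v} V) :
    (facesAbove V {v} 2).card = d ↔ (facesAbove V {v} d).card = d := by
  have hvV := hv.subset (mem_singleton_self v)
  have hrv := rk_singleton_of_mem hV hvV
  have hE : d ≤ (facesAbove V {v} 2).card := by
    simpa [hd] using choose_le_card_facesAbove_vertex hV (IsFaceOf.refl V) hv hvV 1
  have hF : d ≤ (facesAbove V {v} d).card := by
    have h1 := choose_le_card_facesAbove_vertex hV (IsFaceOf.refl V) hv hvV (d - 1)
    rwa [hd, Nat.add_sub_cancel, Nat.choose_symm (by omega : 1 ≤ d), Nat.choose_one_right,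
      Nat.sub_add_cancel (by omega)] at h1
  have hedge : ∀ A B : Finset M, IsFaceOf A V → IsFaceOf B V → v ∈ A → v ∈ B → ¬ A ⊆ B →
      ∃ K ∈ facesAbove V {v} 2, K ⊆ A ∧ ¬ K ⊆ B := by
    intro A B hA hB hvA hvB hAB
    have hAB' := (hA.inter hB).restrict inter_subset_left hA.subset
    obtain ⟨K, hK, hKv, hr⟩ := (hv.restrict (singleton_subset_iff.2 hvA) hA.subset).exists_cover
      hAB' (by simp [hvA, hvB]) fun h => hAB (inter_eq_left.1 h)
    have hvK : v ∈ K := (mem_inter.1 (hKv ▸ mem_singleton_self v)).1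
    refine ⟨K, mem_facesAbove.2 ⟨hK.trans hA, by simpa using hvK, by omega⟩, hK.subset,
      fun h => ?_⟩
    rw [inter_eq_left.2 (subset_inter hK.subset h)] at hKv
    rw [hKv] at hr
    omega
  have hfacet : ∀ A B : Finset M, IsFaceOf A V → IsFaceOf B V → v ∈ A → ¬ B ⊆ A →
      ∃ F ∈ facesAbove V {v} d, A ⊆ F ∧ ¬ B ⊆ F := by
    intro A B hA hB hvA hBA
    obtain ⟨x, hxB, hxA⟩ := not_subset.1 hBA
    obtain ⟨F, hF, hAF, hxF, hr⟩ := hA.exists_facet (hB.subset hxB) hxA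
    exact ⟨F, mem_facesAbove.2 ⟨hF, by simpa using hAF hvA, by omega⟩, hAF,
      fun h => hxF (h hxB)⟩
  have hle₁ : (facesAbove V {v} 2).card = d →
      (facesAbove V {v} d).card ≤ (facesAbove V {v} 2).card := fun hcard => by
    refine card_le_card_of_missing _ _ (fun K F => K ⊆ F) (fun F hF => ?_) (fun F hF => ?_)
      fun F hF G hG hFG => ?_
    · obtain ⟨hF, hvF, hr⟩ := mem_facesAbove.1 hF
      obtain ⟨K, hK, -, hKF⟩ := hedge V F (IsFaceOf.refl V) hF hvV (by simpa using hvF)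
        fun h => by
          have := rk_mono h
          omega
      exact ⟨K, hK, hKF⟩
    · obtain ⟨hF, hvF, hr⟩ := mem_facesAbove.1 hF
      have h1 := choose_le_card_facesAbove_vertex hV hF hv (by simpa using hvF) 1
      rw [hr, Nat.choose_one_right] at h1
      refine (by omega : _ ≤ (facesAbove F {v} (1 + 1)).card + 1).trans
        (Nat.add_le_add_right (card_le_card fun K hK => ?_) 1)
      rw [mem_filter]
      exact ⟨facesAbove_mono hF 2 hK, (mem_facesAbove.1 hK).1.subset⟩
    · obtain ⟨hF, hvF, -⟩ := mem_facesAbove.1 hF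
      obtain ⟨hG, hvG, -⟩ := mem_facesAbove.1 hG
      rw [singleton_subset_iff] at hvF hvG
      refine Subset.antisymm ?_ ?_
      · by_contra hnot
        obtain ⟨K, hK, h1, h2⟩ := hedge F G hF hG hvF hvG hnot
        exact h2 ((hFG K hK).1 h1)
      · by_contra hnot
        obtain ⟨K, hK, h1, h2⟩ := hedge G F hG hF hvG hvF hnot
        exact h2 ((hFG K hK).2 h1)
  have hle₂ : (facesAbove V {v} d).card = d →
      (facesAbove V {v} 2).card ≤ (facesAbove V {v} d).card := fun hcard => by
    refine card_le_card_of_missing _ _ (fun F K => K ⊆ F) (fun K hK => ?_) (fun K hK => ?_)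
      fun K hK L hL hKL => ?_
    · obtain ⟨hK, hvK, hr⟩ := mem_facesAbove.1 hK
      obtain ⟨F, hF, -, hKF⟩ := hfacet {v} K hv hK (mem_singleton_self v) fun h => by
        have := rk_mono h
        omega
      exact ⟨F, hF, hKF⟩
    · obtain ⟨hK, hvK, hr⟩ := mem_facesAbove.1 hK
      have h1 := choose_le_card_facesAbove (n := d - 1) hK (by omega) (d - 2)
      rw [hr, Nat.choose_symm_of_eq_add (by omega : d - 1 = d - 2 + 1), Nat.choose_one_right,
        show 2 + (d - 2) = d by omega] at h1
      refine (by omega : _ ≤ (facesAbove V K d).card + 1).trans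
        (Nat.add_le_add_right (card_le_card fun F hF => ?_) 1)
      obtain ⟨h3, h4, h5⟩ := mem_facesAbove.1 hF
      rw [mem_filter]
      exact ⟨mem_facesAbove.2 ⟨h3, hvK.trans h4, h5⟩, h4⟩
    · obtain ⟨hK, hvK, -⟩ := mem_facesAbove.1 hK
      obtain ⟨hL, hvL, -⟩ := mem_facesAbove.1 hL
      rw [singleton_subset_iff] at hvK hvL
      refine Subset.antisymm ?_ ?_
      · by_contra hnot
        obtain ⟨F, hF, h1, h2⟩ := hfacet L K hL hK hvL hnot
        exact h2 ((hKL F hF).2 h1)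
      · by_contra hnot
        obtain ⟨F, hF, h1, h2⟩ := hfacet K L hK hL hvK hnot
        exact h2 ((hKL F hF).1 h1)
  constructor
  · intro hcard
    have := hle₁ hcard
    omega
  · intro hcard
    have := hle₂ hcard
    omega

theorem two_mul_card_edges_eq_iff (hψ : Set.InjOn ψ V) (hd : rk V = d + 1) (hd2 : 2 ≤ d) :
    2 * (facesAbove V ∅ 2).card = d * (facesAbove V ∅ 1).card ↔
      ∀ v ∈ vertices V, (facesAbove V {v} d).card = d := by
  have hψ' : Set.InjOn (-ψ) V := fun x hx y hy hxy => hψ hx hy (neg_injective hxy)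
  have hsum : 2 * (facesAbove V ∅ 2).card = ∑ v ∈ vertices V, (facesAbove V {v} 2).card := by
    rw [two_mul]
    nth_rw 1 [card_facesAbove_eq_sum hV hψ]
    rw [card_facesAbove_eq_sum hV hψ', ← sum_add_distrib]
    exact sum_congr rfl fun v hv => topFaces_union_eq hV hψ (mem_vertices.1 hv)
  have hle : ∀ v ∈ vertices V, d ≤ (facesAbove V {v} 2).card := fun v hv => by
    have hv := mem_vertices.1 hv
    simpa [hd] using choose_le_card_facesAbove_vertex hV (IsFaceOf.refl V) hv
      (hv.subset (mem_singleton_self v)) 1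
  rw [hsum, card_vertices hV, mul_comm, ← smul_eq_mul, ← sum_const, eq_comm,
    sum_eq_sum_iff_of_le hle]
  refine forall₂_congr fun v hv => ?_
  rw [eq_comm, card_edges_eq_iff_card_facets_eq hV hd hd2 (mem_vertices.1 hv)]

end Normalized

theorem exists_dual_injOn (V : Finset M) :
    ∃ ψ : Dual ℝ M, Set.InjOn ψ V := by
  obtain ⟨ψ, hψ⟩ := Module.exists_dual_forall_apply_ne_zero (K := ℝ)
    (fun p : {p : V × V // p.1 ≠ p.2} => ((p.1.1 : M) - (p.1.2 : M))) fun p =>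
      sub_ne_zero.2 fun h => p.2 (Subtype.ext h)
  refine ⟨ψ, fun x hx y hy hxy => ?_⟩
  by_contra hne
  refine hψ ⟨(⟨x, hx⟩, ⟨y, hy⟩), fun h => hne (congrArg Subtype.val h)⟩ ?_
  rw [map_sub, sub_eq_zero]
  exact hxy

section Homogenization

variable {E : Type*}

/-- The vector configuration obtained from a point configuration by placing it at height one. -/
def homogenize (V : Finset E) : Finset (E × ℝ) := V.image fun x => (x, 1)

theorem mem_homogenize {V : Finset E} {p : E × ℝ} : p ∈ homogenize V ↔ p.1 ∈ V ∧ p.2 = 1 := by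
  obtain ⟨x, r⟩ := p
  simp only [homogenize, mem_image, Prod.mk.injEq]
  constructor
  · rintro ⟨y, hy, rfl, rfl⟩
    exact ⟨hy, rfl⟩
  · rintro ⟨hx, rfl⟩
    exact ⟨x, hx, rfl, rfl⟩

variable [NormedAddCommGroup E] [InnerProductSpace ℝ E]

/-- The convex hull of the points underlying a subset of a homogenized point configuration. -/
def hull (A : Finset (E × ℝ)) : Set E := convexHull ℝ (Prod.fst '' (A : Set (E × ℝ)))

theorem hull_homogenize (V : Finset E) : hull (homogenize V) = convexHull ℝ (V : Set E) := by
  simp [hull, homogenize, Set.image_image]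

theorem apply_mk_one (φ : Dual ℝ (E × ℝ)) (x : E) : φ (x, 1) = φ (x, 0) + φ (0, 1) := by
  rw [← map_add]
  simp

theorem convex_apply_mk_one_eq_zero (φ : Dual ℝ (E × ℝ)) :
    Convex ℝ {x : E | φ (x, 1) = 0} := by
  intro x hx y hy a b _ _ hab
  simp only [Set.mem_ofPred_eq] at hx hy ⊢
  have : ((a • x + b • y, 1) : E × ℝ) = a • (x, (1 : ℝ)) + b • (y, (1 : ℝ)) := by
    ext <;> simp [hab]
  rw [this, map_add, map_smul, map_smul, hx, hy, smul_zero, smul_zero, add_zero]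

theorem hull_eq {V : Finset E} {A : Finset (E × ℝ)} {φ : Dual ℝ (E × ℝ)}
    (hφ : ∀ p ∈ homogenize V, 0 ≤ φ p) (hA : ∀ p, p ∈ A ↔ p ∈ homogenize V ∧ φ p = 0) :
    hull A = {x ∈ convexHull ℝ (V : Set E) | φ (x, 1) = 0} := by
  apply Set.Subset.antisymm
  · refine convexHull_min ?_ ((convex_convexHull ℝ _).inter (convex_apply_mk_one_eq_zero φ))
    rintro _ ⟨p, hp, rfl⟩
    obtain ⟨hpV, h0⟩ := (hA p).1 hp
    obtain ⟨h1, h2⟩ := mem_homogenize.1 hpV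
    refine ⟨subset_convexHull ℝ _ h1, ?_⟩
    have hp1 : (p.1, (1 : ℝ)) = p := Prod.ext rfl h2.symm
    exact (congrArg φ hp1).trans h0
  · rintro x ⟨hx, hx0⟩
    obtain ⟨w, hw0, hw1, hwx⟩ := Finset.mem_convexHull'.1 hx
    have hsum : ∑ y ∈ V, w y * φ (y, 1) = 0 := by
      have : ((x, 1) : E × ℝ) = ∑ y ∈ V, w y • (y, (1 : ℝ)) := by
        ext
        · simp [Prod.fst_sum, hwx]
        · simp [Prod.snd_sum, hw1]
      rw [← hx0, this, map_sum]
      simp only [map_smul, smul_eq_mul]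
    have hnn : ∀ y ∈ V, 0 ≤ w y * φ (y, 1) := fun y hy =>
      mul_nonneg (hw0 y hy) (hφ _ (mem_homogenize.2 ⟨hy, rfl⟩))
    have hzero := (sum_eq_zero_iff_of_nonneg hnn).1 hsum
    have hsupp : ∀ y ∈ V, y ∉ V.filter (fun y => φ (y, 1) = 0) → w y = 0 := fun y hy hy' =>
      (mul_eq_zero.1 (hzero y hy)).resolve_right fun h => hy' (mem_filter.2 ⟨hy, h⟩)
    have hx' : x ∈ convexHull ℝ ((V.filter fun y => φ (y, 1) = 0 : Finset E) : Set E) := by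
      refine Finset.mem_convexHull'.2 ⟨w, fun y hy => hw0 y (mem_filter.1 hy).1, ?_, ?_⟩
      · exact (sum_subset (filter_subset _ _) hsupp).trans hw1
      · refine (sum_subset (filter_subset _ _) fun y hy hy' => ?_).trans hwx
        rw [hsupp y hy hy', zero_smul]
    refine convexHull_mono ?_ hx'
    intro y hy
    obtain ⟨hyV, hy0⟩ := mem_filter.1 hy
    exact ⟨(y, 1), (hA _).2 ⟨mem_homogenize.2 ⟨hyV, rfl⟩, hy0⟩, rfl⟩

theorem IsFaceOf.hull_subset_hull_iff {V : Finset E} {A B : Finset (E × ℝ)}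
    (hA : IsFaceOf A (homogenize V)) (hB : IsFaceOf B (homogenize V)) :
    hull A ⊆ hull B ↔ A ⊆ B := by
  refine ⟨fun h p hp => ?_, fun h => convexHull_mono (Set.image_mono (coe_subset.2 h))⟩
  obtain ⟨φ, hφ, hBφ⟩ := hB
  have hpV := hA.subset hp
  have h1 : p.1 ∈ hull B := h (subset_convexHull ℝ _ ⟨p, hp, rfl⟩)
  rw [hull_eq hφ hBφ] at h1
  refine (hBφ p).2 ⟨hpV, ?_⟩
  rw [← h1.2, ← (mem_homogenize.1 hpV).2]

theorem hull_injOn (V : Finset E) :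
    Set.InjOn (hull (E := E)) {A | IsFaceOf A (homogenize V)} := fun _ hA _ hB h =>
  Subset.antisymm ((hA.hull_subset_hull_iff hB).1 h.subset)
    ((hB.hull_subset_hull_iff hA).1 h.symm.subset)

theorem dimSet_hull {A : Finset (E × ℝ)} (hA : ∀ p ∈ A, p.2 = 1) (hne : A.Nonempty) :
    dimSet (hull A) + 1 = rk A := by
  obtain ⟨p, hp⟩ := hne
  set S : Set E := Prod.fst '' (A : Set (E × ℝ)) with hS
  have hpS : p.1 ∈ S := ⟨p, hp, rfl⟩
  have hfin : S.Finite := A.finite_toSet.image _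
  have : FiniteDimensional ℝ (vectorSpan ℝ S) := finiteDimensional_vectorSpan_of_finite ℝ hfin
  have hdim : dimSet (hull A) = finrank ℝ (vectorSpan ℝ S) := by
    rw [dimSet, hull, affineSpan_convexHull, direction_affineSpan]
  have hspan : span ℝ (A : Set (E × ℝ)) =
      (vectorSpan ℝ S).map (LinearMap.inl ℝ E ℝ) ⊔ span ℝ {p} := by
    apply le_antisymm
    · refine span_le.2 fun q hq => ?_
      have hmem : q.1 - p.1 ∈ vectorSpan ℝ S := vsub_mem_vectorSpan ℝ ⟨q, hq, rfl⟩ hpS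
      have heq : q = LinearMap.inl ℝ E ℝ (q.1 - p.1) + p := by
        ext <;> simp [hA q hq, hA p hp]
      rw [heq]
      exact add_mem (mem_sup_left (mem_map_of_mem hmem))
        (mem_sup_right (mem_span_singleton_self p))
    · refine sup_le ?_ (span_mono (by simpa using hp))
      rw [vectorSpan_eq_span_vsub_set_right ℝ hpS, map_span, span_le]
      rintro _ ⟨_, ⟨_, ⟨q, hq, rfl⟩, rfl⟩, rfl⟩
      have heq : LinearMap.inl ℝ E ℝ (q.1 -ᵥ p.1) = q - p := by
        ext <;> simp [hA q hq, hA p hp]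
      simp only [heq]
      exact sub_mem (subset_span hq) (subset_span hp)
  have hdisj : (vectorSpan ℝ S).map (LinearMap.inl ℝ E ℝ) ⊓ span ℝ {p} = ⊥ := by
    rw [eq_bot_iff]
    rintro x ⟨⟨u, -, rfl⟩, hx⟩
    obtain ⟨c, hc⟩ := mem_span_singleton.1 hx
    have h0 : c = 0 := by
      have := congrArg Prod.snd hc
      simpa [hA p hp] using this
    rw [← hc, h0, zero_smul]
    exact zero_mem _
  have hp0 : p ≠ 0 := by
    rintro rfl
    simpa using hA 0 hp
  have hsum := finrank_sup_add_finrank_inf_eq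
    ((vectorSpan ℝ S).map (LinearMap.inl ℝ E ℝ)) (span ℝ {p})
  rw [hdisj, finrank_bot, ← hspan, finrank_span_singleton hp0,
    ← (equivMapOfInjective _ LinearMap.inl_injective _).finrank_eq] at hsum
  rw [hdim, rk]
  omega

theorem rk_homogenize {V : Finset E} (hV : V.Nonempty) :
    rk (homogenize V) = dimSet (convexHull ℝ (V : Set E)) + 1 := by
  rw [← hull_homogenize]
  exact (dimSet_hull (fun p hp => (mem_homogenize.1 hp).2) (hV.image _)).symm

variable [FiniteDimensional ℝ E]

theorem isKFace_hull {V : Finset E} {A : Finset (E × ℝ)} {k : ℕ}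
    (hA : IsFaceOf A (homogenize V)) (hr : rk A = k + 1) :
    IsKFace (convexHull ℝ (V : Set E)) k (hull A) := by
  have hne := nonempty_of_rk_ne_zero (by omega : rk A ≠ 0)
  have hdim := dimSet_hull (fun p hp => (mem_homogenize.1 (hA.subset hp)).2) hne
  have hhull : (hull A).Nonempty := by
    obtain ⟨p, hp⟩ := hne
    exact ⟨p.1, subset_convexHull ℝ _ ⟨p, hp, rfl⟩⟩
  refine ⟨?_, hhull, by omega⟩
  obtain ⟨φ, hφ, hAφ⟩ := hA
  have heq := hull_eq hφ hAφ
  set f : E →L[ℝ] ℝ := -(φ ∘ₗ LinearMap.inl ℝ E ℝ).toContinuousLinearMap with hf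
  have hfφ : ∀ x, φ (x, 1) = φ (0, 1) - f x := fun x => by
    rw [apply_mk_one, hf]
    simp [add_comm]
  by_cases h0 : f = 0
  · left
    rw [heq, Set.sep_eq_self_iff_mem_true]
    obtain ⟨y, hy⟩ := hhull
    rw [heq] at hy
    intro x _
    have := hy.2
    rw [hfφ, h0] at this ⊢
    simpa using this
  · refine Or.inr (Or.inr ⟨f, h0, φ (0, 1), ?_, ?_⟩)
    · intro x hx
      refine convexHull_min (t := {x | f x ≤ φ (0, 1)}) (fun y hy => ?_)
        (convex_halfSpace_le f.toLinearMap.isLinear _) hx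
      have := hφ (y, 1) (mem_homogenize.2 ⟨hy, rfl⟩)
      rw [hfφ] at this
      simpa using this
    · rw [heq]
      ext x
      refine and_congr_right fun _ => ?_
      rw [hfφ x, sub_eq_zero, eq_comm]

omit [FiniteDimensional ℝ E] in
theorem exists_hull_eq {V : Finset E} {G : Set E} {k : ℕ}
    (hG : IsKFace (convexHull ℝ (V : Set E)) k G) :
    ∃ A, IsFaceOf A (homogenize V) ∧ rk A = k + 1 ∧ hull A = G := by
  obtain ⟨hface, hne, hdim⟩ := hG
  obtain ⟨A, hA, rfl⟩ : ∃ A, IsFaceOf A (homogenize V) ∧ hull A = G := by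
    rcases hface with rfl | rfl | ⟨f, -, c, hfc, rfl⟩
    · exact ⟨_, IsFaceOf.refl _, hull_homogenize V⟩
    · exact absurd hne Set.not_nonempty_empty
    · set φ : Dual ℝ (E × ℝ) :=
        c • LinearMap.snd ℝ E ℝ - f.toLinearMap ∘ₗ LinearMap.fst ℝ E ℝ with hφdef
      have hφ : ∀ p ∈ homogenize V, 0 ≤ φ p := fun p hp => by
        obtain ⟨h1, h2⟩ := mem_homogenize.1 hp
        simpa [hφdef, h2] using hfc p.1 (subset_convexHull ℝ _ h1)
      refine ⟨_, isFaceOf_filter hφ, ?_⟩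
      rw [hull_eq hφ (by simp)]
      ext x
      refine and_congr_right fun _ => ?_
      have hφx : φ (x, 1) = c - f x := by simp [hφdef]
      rw [hφx, sub_eq_zero, eq_comm]
  refine ⟨A, hA, ?_, rfl⟩
  rw [← hdim, dimSet_hull fun p hp => (mem_homogenize.1 (hA.subset hp)).2]
  rw [nonempty_iff_ne_empty]
  rintro rfl
  simp [hull] at hne

theorem ncard_kFaces_containing {V : Finset E} {B : Finset (E × ℝ)}
    (hB : IsFaceOf B (homogenize V)) (k : ℕ) :
    {G | IsKFace (convexHull ℝ (V : Set E)) k G ∧ hull B ⊆ G}.ncard =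
      (facesAbove (homogenize V) B (k + 1)).card := by
  rw [← Set.ncard_coe_finset, ← Set.InjOn.ncard_image
    ((hull_injOn V).mono fun A hA => (mem_facesAbove.1 hA).1)]
  congr 1
  ext G
  constructor
  · rintro ⟨hG, hBG⟩
    obtain ⟨A, hA, hr, rfl⟩ := exists_hull_eq hG
    exact ⟨A, mem_facesAbove.2 ⟨hA, (hB.hull_subset_hull_iff hA).1 hBG, hr⟩, rfl⟩
  · rintro ⟨A, hA, rfl⟩
    obtain ⟨hA, hBA, hr⟩ := mem_facesAbove.1 hA
    exact ⟨isKFace_hull hA hr, (hB.hull_subset_hull_iff hA).2 hBA⟩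

theorem fVec_eq (V : Finset E) (k : ℕ) :
    fVec (convexHull ℝ (V : Set E)) k = (facesAbove (homogenize V) ∅ (k + 1)).card := by
  rw [fVec, ← Set.ncard_coe_finset, ← Set.InjOn.ncard_image
    ((hull_injOn V).mono fun A hA => (mem_facesAbove.1 hA).1)]
  congr 1
  ext G
  constructor
  · intro hG
    obtain ⟨A, hA, hr, rfl⟩ := exists_hull_eq hG
    exact ⟨A, mem_facesAbove.2 ⟨hA, empty_subset _, hr⟩, rfl⟩
  · rintro ⟨A, hA, rfl⟩
    obtain ⟨hA, -, hr⟩ := mem_facesAbove.1 hA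
    exact isKFace_hull hA hr

theorem isSimplePolytope_iff {V : Finset E} {d : ℕ} (hd : 1 ≤ d) :
    IsSimplePolytope (convexHull ℝ (V : Set E)) d ↔
      ∀ v ∈ vertices (homogenize V), (facesAbove (homogenize V) {v} d).card = d := by
  have hV : ∀ p ∈ homogenize V, LinearMap.snd ℝ E ℝ p = 1 := fun p hp => (mem_homogenize.1 hp).2
  obtain ⟨d, rfl⟩ : ∃ e, d = e + 1 := ⟨d - 1, by omega⟩
  rw [IsSimplePolytope, Nat.add_sub_cancel]
  constructor
  · intro h v hv
    have hv := mem_vertices.1 hv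
    rw [← ncard_kFaces_containing hv]
    exact h _ (isKFace_hull hv (rk_singleton_of_mem hV (hv.subset (mem_singleton_self v))))
  · intro h G hG
    obtain ⟨A, hA, hr, rfl⟩ := exists_hull_eq hG
    rw [ncard_kFaces_containing hA]
    obtain ⟨v, -, rfl⟩ := eq_singleton_of_rk_eq_one hV hA.subset hr
    exact h v (mem_vertices.2 hA)

end Homogenization

end VectorConfig

/-- For a `d`-polytope `P` and `0 ≤ k ≤ d-1`, equality
`f_k(P) = ρ(d,k) ⬝ f_0(P)` holds iff `k = 0`, or `k = 1` and `P` is simple. -/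
theorem face_count_vertices_equality_iff {N : ℕ} (d k : ℕ) (P : Set (Euc N))
    (hP : IsPolytope P) (hd : dimSet P = d) (hk : k + 1 ≤ d) :
    (fVec P k : ℚ) = rho d k * (fVec P 0 : ℚ) ↔
      k = 0 ∨ (k = 1 ∧ IsSimplePolytope P d) := by
  obtain ⟨V, rfl⟩ := hP
  set W := VectorConfig.homogenize V with hW
  have hV : ∀ p ∈ W, LinearMap.snd ℝ (Euc N) ℝ p = 1 := fun p hp =>
    (VectorConfig.mem_homogenize.1 hp).2
  have hVne : V.Nonempty := by
    rw [Finset.nonempty_iff_ne_empty]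
    rintro rfl
    rw [dimSet, Finset.coe_empty, convexHull_empty, AffineSubspace.span_empty,
      AffineSubspace.direction_bot, finrank_bot] at hd
    omega
  have hrk : VectorConfig.rk W = d + 1 := by
    rw [VectorConfig.rk_homogenize hVne, hd]
  obtain ⟨ψ, hψ⟩ := VectorConfig.exists_dual_injOn W
  rw [VectorConfig.fVec_eq, VectorConfig.fVec_eq, ← hW, zero_add]
  rcases Nat.lt_trichotomy k 1 with h | rfl | h
  · obtain rfl : k = 0 := by omega
    simp [rho]
  · rw [VectorConfig.isSimplePolytope_iff (by omega), ← hW,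
      ← VectorConfig.two_mul_card_edges_eq_iff hV hψ hrk hk, rho, Nat.choose_one_right,
      Nat.choose_one_right, ← Nat.cast_add, show (d + 1) / 2 + d / 2 = d by omega, div_mul_eq_mul_div,
      eq_div_iff two_ne_zero, mul_comm _ (2 : ℚ)]
    norm_num
    exact_mod_cast Iff.rfl
  · have hlt := VectorConfig.mul_card_lt_two_mul_card hV hψ hrk h (by omega : k ≤ d)
    have hlt' : ((((d + 1) / 2).choose k + (d / 2).choose k : ℕ) : ℚ) *
        (VectorConfig.facesAbove W ∅ 1).card < 2 * (VectorConfig.facesAbove W ∅ (k + 1)).card := by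
      exact_mod_cast hlt
    refine iff_of_false (fun heq => ?_) (by omega)
    rw [heq, rho] at hlt'
    push_cast at hlt'
    linarith
end
end
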